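/- arXiv:1909.04281 — 10 statements merged into one kernel-verified Lean document; each statement's English description precedes it below -/
import Mathlib

section
/- Suppose the weight vector w satisfies r₁ ≤_w r₂ ≤_w ⋯ ≤_w r_k. If n ∈ S and a ∈ Z_S(n) satisfies a₁ + ⋯ + a_k ≥ r₁, then there exists a factorization b ∈ Z_S(n) with |b|_w ≥ |a|_w and b₁ > 0. -/
open Finset

/-- A family of at least `m > 0` natural numbers, given with multiplicities `a`, has a nonempty
subfamily whose sum is divisible by `m`. -/
theorem exists_le_ne_zero_dvd_sum_mul {ι : Type*} [Fintype ι] [DecidableEq ι] {m : ℕ} (hm : 0 < m)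
    (r a : ι → ℕ) (h : m ≤ ∑ i, a i) :
    ∃ c : ι → ℕ, c ≤ a ∧ c ≠ 0 ∧ m ∣ ∑ i, c i * r i := by
  obtain ⟨l, hl⟩ : ∃ l : List ι, ∀ i, l.count i = a i :=
    ⟨(∑ i, Multiset.replicate (a i) i).toList, fun i => by
      rw [← Multiset.coe_count, Multiset.coe_toList, Multiset.count_sum']
      simp [Multiset.count_replicate]⟩
  have count_sum (l : List ι) : ∑ i, l.count i = l.length := by
    simpa using Multiset.sum_count_eq_card (s := univ) (m := (l : Multiset ι)) (by simp)
  have hlen : m ≤ l.length := by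
    rw [← count_sum]
    simpa [hl] using h
  let p : ℕ → ι → ℕ := fun j i => (l.take j).count i
  obtain ⟨x, hx, y, hy, hxy, he⟩ := Finset.exists_ne_map_eq_of_card_lt_of_maps_to
    (s := range (m + 1)) (t := range m) (f := fun j => (∑ i, p j i * r i) % m)
    (by simp) (fun j _ => by simpa using Nat.mod_lt _ hm)
  wlog hlt : x < y generalizing x y
  · exact this y hy x hx hxy.symm he.symm (by omega)
  have hp : p x ≤ p y := fun i =>
    (List.take_sublist_take_left hlt.le).count_le i
  refine ⟨p y - p x, fun i => ?_, fun h0 => ?_, ?_⟩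
  · exact (Nat.sub_le _ _).trans (((List.take_sublist y l).count_le i).trans (hl i).le)
  · have hle : p y ≤ p x := tsub_eq_zero_iff_le.mp h0
    have := Finset.sum_le_sum fun i (_ : i ∈ univ) => hle i
    simp only [p, count_sum, List.length_take] at this
    simp only [mem_range] at hx hy
    omega
  · have hs : ∑ i, (p y - p x) i * r i = ∑ i, p y i * r i - ∑ i, p x i * r i := by
      rw [← Finset.sum_tsub_distrib _ fun i _ => Nat.mul_le_mul_right _ (hp i)]
      simp [Nat.sub_mul]
    rw [hs]
    exact (Nat.modEq_iff_dvd' (Finset.sum_le_sum fun i _ => Nat.mul_le_mul_right _ (hp i))).mp he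

/-- Lemma (weighted length, part (a)): if a factorization `a` of `n` in
`S = ⟨r₁,…,r_k⟩` has total length at least `r₁`, then some factorization `b` of `n`
has weighted length at least that of `a` and positive first coordinate.
Generators are indexed by `Fin (k+1)` with `k ≥ 1` (so there are at least 2 generators);
the first generator is `r 0`. -/
theorem stmt_0 (k : ℕ) (hk : 1 ≤ k) (r : Fin (k+1) → ℕ) (hr : ∀ i, 0 < r i)
    (w : Fin (k+1) → ℚ)
    (hsort : ∀ i j : Fin (k+1), i ≤ j → w j / (r j : ℚ) ≤ w i / (r i : ℚ))
    (n : ℕ) (a : Fin (k+1) → ℕ)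
    (ha : n = ∑ i, a i * r i)
    (hbig : r 0 ≤ ∑ i, a i) :
    ∃ b : Fin (k+1) → ℕ, n = ∑ i, b i * r i ∧
      ∑ i, (a i : ℚ) * w i ≤ ∑ i, (b i : ℚ) * w i ∧ 0 < b 0 := by
  obtain ⟨c, hca, hc0, q, hq⟩ := exists_le_ne_zero_dvd_sum_mul (hr 0) r a hbig
  have hq0 : 0 < q := by
    obtain ⟨i, hi⟩ := Function.ne_iff.mp hc0
    have hpos : 0 < ∑ i, c i * r i :=
      Finset.sum_pos' (fun _ _ => Nat.zero_le _)
        ⟨i, mem_univ i, Nat.mul_pos (Nat.pos_of_ne_zero hi) (hr i)⟩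
    rw [hq] at hpos
    exact Nat.pos_of_mul_pos_left hpos
  obtain ⟨d, rfl⟩ := exists_add_of_le hca
  refine ⟨d + Pi.single 0 q, ?_, ?_, ?_⟩
  · have hs : ∑ i, (Pi.single 0 q : Fin (k + 1) → ℕ) i * r i = q * r 0 := by
      simp [Pi.single_apply]
    simp only [ha, Pi.add_apply, add_mul, Finset.sum_add_distrib, hq, hs]
    ring
  · have hw : ∑ i, (c i : ℚ) * w i ≤ q * w 0 := by
      have h0 : (0 : ℚ) < r 0 := by exact_mod_cast hr 0
      calc ∑ i, (c i : ℚ) * w i ≤ ∑ i, (c i : ℚ) * (r i * (w 0 / r 0)) := by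
            gcongr with i
            have hi : (0 : ℚ) < r i := by exact_mod_cast hr i
            exact (div_le_iff₀' hi).mp (hsort 0 i (Fin.zero_le i))
        _ = (∑ i, (c i : ℚ) * r i) * (w 0 / r 0) := by
            simp_rw [← mul_assoc, Finset.sum_mul]
        _ = (r 0 * q) * (w 0 / r 0) := by
            congr 1
            exact_mod_cast hq
        _ = q * w 0 := by field_simp
    have hs : ∑ i, ((Pi.single 0 q : Fin (k + 1) → ℕ) i : ℚ) * w i = q * w 0 := by
      simp [Pi.single_apply]
    simp only [Pi.add_apply, Nat.cast_add, add_mul, Finset.sum_add_distrib, hs]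
    linarith
  · simp [hq0]
end

section
/- Suppose the weight vector w satisfies r₁ ≤_w r₂ ≤_w ⋯ ≤_w r_k. If n ∈ S and a ∈ Z_S(n) satisfies a₁ + ⋯ + a_k ≥ r_k, then there exists a factorization b ∈ Z_S(n) with |b|_w ≤ |a|_w and b_k > 0. -/
open Finset

/-- Every vector of naturals dominates a vector whose coordinate sum is one smaller
(or zero, if the sum was already zero). -/
lemma exists_le_sum_eq_sub_one {ι : Type*} [Fintype ι] (c : ι → ℕ) :
    ∃ d ≤ c, ∑ i, d i = ∑ i, c i - 1 := by
  classical
  by_cases h : ∃ i, 0 < c i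
  · obtain ⟨i, hi⟩ := h
    refine ⟨Function.update c i (c i - 1), ?_, ?_⟩
    · simp
    · rw [sum_update_of_mem (mem_univ i),
        ← add_sum_erase univ c (mem_univ i), sdiff_singleton_eq_erase]
      omega
  · push Not at h
    have hc : ∀ i, c i = 0 := fun i => Nat.le_zero.mp (h i)
    exact ⟨c, le_rfl, by simp [hc]⟩

/-- If the coordinates of `a` sum to at least `m > 0`, then some `0 ≠ c ≤ a` has
`∑ i, c i * r i` divisible by `m`. -/
lemma exists_le_dvd_sum_mul {ι : Type*} [Fintype ι] (r a : ι → ℕ) {m : ℕ} (hm : 0 < m)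
    (h : m ≤ ∑ i, a i) :
    ∃ c ≤ a, 0 < ∑ i, c i ∧ m ∣ ∑ i, c i * r i := by
  choose g hg hgs using exists_le_sum_eq_sub_one (ι := ι)
  let f : ℕ → ι → ℕ := fun j => g^[j] a
  have hf : ∀ j, f (j + 1) = g (f j) := fun j => Function.iterate_succ_apply' g j a
  have hanti : Antitone f := antitone_nat_of_succ_le fun j => (hf j).symm ▸ hg _
  have hsum : ∀ j, ∑ i, f j i = ∑ i, a i - j := by
    intro j
    induction j with
    | zero => rfl
    | succ j ih => rw [hf, hgs, ih, Nat.sub_sub]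
  have key : ∀ x y, x < y → y ≤ m →
      (∑ i, f x i * r i) % m = (∑ i, f y i * r i) % m →
      ∃ c ≤ a, 0 < ∑ i, c i ∧ m ∣ ∑ i, c i * r i := by
    intro x y hxy hy he
    have hle : f y ≤ f x := hanti hxy.le
    refine ⟨f x - f y, tsub_le_self.trans (hanti (Nat.zero_le x)), ?_, ?_⟩
    · simp only [Pi.sub_apply]
      rw [sum_tsub_distrib _ fun i _ => hle i, hsum, hsum]
      omega
    · simp only [Pi.sub_apply, Nat.sub_mul]
      rw [sum_tsub_distrib _ fun i _ => Nat.mul_le_mul_right _ (hle i)]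
      exact (Nat.modEq_iff_dvd' (sum_le_sum fun i _ => Nat.mul_le_mul_right _ (hle i))).mp he.symm
  obtain ⟨x, hx, y, hy, hne, he⟩ := exists_ne_map_eq_of_card_lt_of_maps_to
    (s := range (m + 1)) (t := range m) (f := fun j => (∑ i, f j i * r i) % m)
    (by simp) (fun j _ => by simpa using Nat.mod_lt _ hm)
  rw [mem_range] at hx hy
  rcases lt_or_gt_of_ne hne with hlt | hlt
  · exact key x y hlt (by omega) he
  · exact key y x hlt (by omega) he.symm

/-- Lemma (weighted length, part (b)): if a factorization `a` of `n` in
`S = ⟨r₁,…,r_k⟩` has total length at least `r_k`, then some factorization `b` of `n`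
has weighted length at most that of `a` and positive last coordinate.
Generators are indexed by `Fin (k+1)` with `k ≥ 1` (so there are at least 2 generators);
the last generator is `r (Fin.last k)`. -/
theorem stmt_1 (k : ℕ) (hk : 1 ≤ k) (r : Fin (k+1) → ℕ) (hr : ∀ i, 0 < r i)
    (w : Fin (k+1) → ℚ)
    (hsort : ∀ i j : Fin (k+1), i ≤ j → w j / (r j : ℚ) ≤ w i / (r i : ℚ))
    (n : ℕ) (a : Fin (k+1) → ℕ)
    (ha : n = ∑ i, a i * r i)
    (hbig : r (Fin.last k) ≤ ∑ i, a i) :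
    ∃ b : Fin (k+1) → ℕ, n = ∑ i, b i * r i ∧
      ∑ i, (b i : ℚ) * w i ≤ ∑ i, (a i : ℚ) * w i ∧ 0 < b (Fin.last k) := by
  obtain ⟨c, hca, hc, q, hq⟩ := exists_le_dvd_sum_mul r a (hr (Fin.last k)) hbig
  have hr' : ∀ i, (0 : ℚ) < r i := fun i => by exact_mod_cast hr i
  have hqpos : 0 < q := by
    have hlt : 0 < ∑ i, c i * r i :=
      hc.trans_le (sum_le_sum fun i _ => Nat.le_mul_of_pos_right _ (hr i))
    rw [hq] at hlt
    exact Nat.pos_of_mul_pos_left hlt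
  have hweight : (q : ℚ) * w (Fin.last k) ≤ ∑ i, (c i : ℚ) * w i := by
    have hqQ : ∑ i, (c i : ℚ) * r i = r (Fin.last k) * q := by exact_mod_cast hq
    calc (q : ℚ) * w (Fin.last k)
        = (r (Fin.last k) * q) * (w (Fin.last k) / r (Fin.last k)) := by
          have := (hr' (Fin.last k)).ne'
          field_simp
      _ = ∑ i, (c i : ℚ) * r i * (w (Fin.last k) / r (Fin.last k)) := by
          rw [← hqQ, sum_mul]
      _ ≤ ∑ i, (c i : ℚ) * w i := by
          refine sum_le_sum fun i _ => ?_
          rw [mul_assoc]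
          refine mul_le_mul_of_nonneg_left ?_ (Nat.cast_nonneg _)
          rw [mul_comm]
          exact (le_div_iff₀ (hr' i)).mp (hsort i _ (Fin.le_last i))
  refine ⟨fun i => (a i - c i) + if i = Fin.last k then q else 0, ?_, ?_, ?_⟩
  · have hle : ∑ i, c i * r i ≤ ∑ i, a i * r i :=
      sum_le_sum fun i _ => Nat.mul_le_mul_right _ (hca i)
    simp only [add_mul, sum_add_distrib, ite_mul, zero_mul, sum_ite_eq', mem_univ, if_true,
      Nat.sub_mul]
    rw [sum_tsub_distrib _ fun i _ => Nat.mul_le_mul_right _ (hca i), mul_comm q, ← hq,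
      Nat.sub_add_cancel hle, ha]
  · have hcast : ∀ i, ((a i - c i : ℕ) : ℚ) = a i - c i := fun i => Nat.cast_sub (hca i)
    simp only [Nat.cast_add, hcast, Nat.cast_ite, Nat.cast_zero, add_mul, sub_mul,
      sum_add_distrib, sum_sub_distrib, ite_mul, zero_mul, sum_ite_eq', mem_univ, if_true]
    linarith
  · simp [hqpos]
end

section
/- Suppose the weight vector w satisfies r₁ ≤_w r₂ ≤_w ⋯ ≤_w r_k. For every n ∈ S with n > R², the element n − r₁ belongs to S and the maximum weighted length function satisfies M_w(n) = M_w(n − r₁) + w₁. -/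
open Finset

/-- A list of at least `m > 0` natural numbers has a nonempty sublist with sum divisible by `m`. -/
theorem exists_sublist_dvd_sum_map {ι : Type*} (r : ι → ℕ) {m : ℕ} (hm : 0 < m) (l : List ι)
    (hl : m ≤ l.length) : ∃ s : List ι, s.Sublist l ∧ s ≠ [] ∧ m ∣ (s.map r).sum := by
  obtain ⟨a, ha, b, hb, hne, hab⟩ := Finset.exists_ne_map_eq_of_card_lt_of_maps_to
    (s := Finset.range (m + 1)) (t := Finset.range m)
    (f := fun j => ((l.take j).map r).sum % m) (by simp)
    (fun j _ => by simpa using Nat.mod_lt _ hm)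
  wlog hlt : a < b generalizing a b
  · exact this b hb a ha hne.symm hab.symm (by omega)
  simp only [Finset.mem_range] at ha hb
  refine ⟨(l.take b).drop a, (List.drop_sublist _ _).trans (List.take_sublist _ _), ?_, ?_⟩
  · rw [← List.length_pos_iff]
    simp only [List.length_drop, List.length_take]
    omega
  · have hsplit : ((l.take b).map r).sum
        = ((l.take a).map r).sum + (((l.take b).drop a).map r).sum := by
      conv_lhs => rw [← List.take_append_drop a (l.take b)]
      rw [List.map_append, List.sum_append, List.take_take, min_eq_left hlt.le]
    have hdvd := (Nat.modEq_iff_dvd' (by omega)).1 hab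
    rwa [hsplit, Nat.add_sub_cancel_left] at hdvd

/-- A multiplicity vector of total at least `m > 0` dominates a nonzero one whose weighted sum is
divisible by `m`. -/
theorem exists_le_ne_zero_dvd_sum {ι : Type*} [Fintype ι] (r : ι → ℕ) {m : ℕ} (hm : 0 < m)
    (z : ι → ℕ) (hz : m ≤ ∑ i, z i) :
    ∃ u : ι → ℕ, u ≤ z ∧ u ≠ 0 ∧ m ∣ ∑ i, u i * r i := by
  classical
  set t : Multiset ι := ∑ i, Multiset.replicate (z i) i with ht
  have hcount (i : ι) : t.count i = z i := by
    simp [ht, Multiset.count_sum', Multiset.count_replicate]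
  obtain ⟨s, hst, hs, hdvd⟩ := exists_sublist_dvd_sum_map r hm t.toList (by simpa [ht] using hz)
  refine ⟨fun i => s.count i, fun i => ?_, fun h => ?_, ?_⟩
  · rw [← hcount i, ← Multiset.coe_toList t, Multiset.coe_count]
    exact hst.count_le i
  · obtain ⟨i, hi⟩ := List.exists_mem_of_ne_nil s hs
    exact (List.count_pos_iff.2 hi).ne' (congrFun h i)
  · rw [Finset.sum_list_map_count] at hdvd
    convert hdvd using 1
    symm
    refine Finset.sum_subset (Finset.subset_univ _) fun i _ hi => ?_
    simp [List.count_eq_zero.2 (by simpa using hi)]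

/-- If generator `a` has the largest weight per unit, a factorization of an element larger than the
square of a bound on the generators can be replaced by one that uses `a` and is at least as long. -/
theorem exists_factorization_using {ι : Type*} [Fintype ι] [DecidableEq ι] (r : ι → ℕ)
    (hr : ∀ i, 0 < r i) (w : ι → ℚ) (a : ι)
    (ha : ∀ i, w i / (r i : ℚ) ≤ w a / (r a : ℚ)) {R : ℕ} (hR : ∀ i, r i ≤ R)
    (z : ι → ℕ) (hz : R ^ 2 < ∑ i, z i * r i) :
    ∃ y : ι → ℕ, ∑ i, z i * r i = ∑ i, y i * r i + r a ∧
      ∑ i, (z i : ℚ) * w i ≤ ∑ i, (y i : ℚ) * w i + w a := by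
  have hcard : r a ≤ ∑ i, z i := by
    have h : ∑ i, z i * r i ≤ (∑ i, z i) * R := by
      rw [Finset.sum_mul]
      exact Finset.sum_le_sum fun i _ => Nat.mul_le_mul_left _ (hR i)
    have h' : R * R < (∑ i, z i) * R := by nlinarith
    exact (hR a).trans (Nat.lt_of_mul_lt_mul_right h').le
  obtain ⟨u, huz, hu, c, hc⟩ := exists_le_ne_zero_dvd_sum r (hr a) z hcard
  have hcpos : 0 < c := by
    obtain ⟨i, hi⟩ := Function.ne_iff.1 hu
    refine Nat.pos_of_ne_zero fun h => ?_
    rw [h, mul_zero, Finset.sum_eq_zero_iff] at hc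
    exact (Nat.mul_pos (Nat.pos_of_ne_zero hi) (hr i)).ne' (hc i (Finset.mem_univ i))
  obtain ⟨d, rfl⟩ : ∃ d, c = d + 1 := ⟨c - 1, by omega⟩
  obtain ⟨v, rfl⟩ : ∃ v, z = u + v := ⟨z - u, (add_tsub_cancel_of_le huz).symm⟩
  refine ⟨v + Pi.single a d, ?_, ?_⟩
  · simp only [Pi.add_apply, add_mul, Finset.sum_add_distrib, hc, Pi.single_apply, ite_mul,
      zero_mul, Finset.sum_ite_eq', Finset.mem_univ, if_true]
    ring
  · have hra : (0 : ℚ) < r a := by exact_mod_cast hr a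
    have hcQ : ∑ i, (u i : ℚ) * r i = r a * (d + 1) := by exact_mod_cast hc
    have hle : ∑ i, (u i : ℚ) * w i ≤ (d + 1) * w a := by
      calc ∑ i, (u i : ℚ) * w i ≤ ∑ i, (u i : ℚ) * r i * (w a / r a) := by
            refine Finset.sum_le_sum fun i _ => ?_
            have hri : (0 : ℚ) < r i := by exact_mod_cast hr i
            rw [mul_assoc]
            refine mul_le_mul_of_nonneg_left ?_ (Nat.cast_nonneg _)
            rw [mul_comm]
            exact (div_le_iff₀ hri).1 (ha i)
        _ = (d + 1) * w a := by
            rw [← Finset.sum_mul, hcQ]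
            field_simp
    simp only [Pi.add_apply, Nat.cast_add, add_mul, Finset.sum_add_distrib, Pi.single_apply,
      Nat.cast_ite, Nat.cast_zero, ite_mul, zero_mul, Finset.sum_ite_eq', Finset.mem_univ, if_true]
    linarith

/-- An element has finitely many factorizations over positive generators. -/
theorem finite_factorizations {ι : Type*} [Fintype ι] (r : ι → ℕ) (hr : ∀ i, 0 < r i) (n : ℕ) :
    {z : ι → ℕ | n = ∑ i, z i * r i}.Finite := by
  classical
  refine (Set.finite_Iic (fun _ : ι => n)).subset fun z hz i => ?_
  rw [Set.mem_ofPred_eq] at hz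
  change z i ≤ n
  calc z i ≤ z i * r i := Nat.le_mul_of_pos_right _ (hr i)
    _ ≤ ∑ j, z j * r j :=
      Finset.single_le_sum (f := fun j => z j * r j) (fun _ _ => Nat.zero_le _) (Finset.mem_univ i)
    _ = n := hz.symm

/-- Theorem (max weighted length is eventually quasilinear): for `n ∈ S` with `n > R²`
(where `R = max rᵢ`), we have `n - r₁ ∈ S` and `M_w(n) = M_w(n - r₁) + w₁`.
Here `L N` is the weighted length set of `N`, and the maximum weighted length is
expressed via `IsGreatest`. -/
theorem stmt_2 (k : ℕ) (hk : 1 ≤ k) (r : Fin (k+1) → ℕ) (hr : ∀ i, 0 < r i)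
    (w : Fin (k+1) → ℚ)
    (hsort : ∀ i j : Fin (k+1), i ≤ j → w j / (r j : ℚ) ≤ w i / (r i : ℚ))
    (L : ℕ → Set ℚ)
    (hL : ∀ N : ℕ, L N = {q | ∃ z : Fin (k+1) → ℕ,
      N = ∑ i, z i * r i ∧ q = ∑ i, (z i : ℚ) * w i})
    (n : ℕ) (hnS : ∃ z : Fin (k+1) → ℕ, n = ∑ i, z i * r i)
    (hn : (Finset.univ.sup r) ^ 2 < n) :
    (∃ z : Fin (k+1) → ℕ, n - r 0 = ∑ i, z i * r i) ∧
    ∃ M M' : ℚ, IsGreatest (L n) M ∧ IsGreatest (L (n - r 0)) M' ∧ M = M' + w 0 := by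
  have key (z : Fin (k+1) → ℕ) (hz : n = ∑ i, z i * r i) :
      ∃ y : Fin (k+1) → ℕ, n = ∑ i, y i * r i + r 0 ∧
        ∑ i, (z i : ℚ) * w i ≤ ∑ i, (y i : ℚ) * w i + w 0 := by
    obtain ⟨y, hy, hle⟩ := exists_factorization_using r hr w 0
      (fun i => hsort 0 i (Fin.zero_le i)) (fun i => Finset.le_sup (Finset.mem_univ i)) z (hz ▸ hn)
    exact ⟨y, hz.trans hy, hle⟩
  obtain ⟨z, hz⟩ := hnS
  obtain ⟨y, hy, -⟩ := key z hz
  have hyS : n - r 0 = ∑ i, y i * r i := by omega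
  refine ⟨⟨y, hyS⟩, ?_⟩
  obtain ⟨x, hx, hmax⟩ := Set.exists_max_image _ (fun x => ∑ i, (x i : ℚ) * w i)
    (finite_factorizations r hr (n - r 0)) ⟨y, hyS⟩
  rw [Set.mem_ofPred_eq] at hx
  refine ⟨_, ∑ i, (x i : ℚ) * w i, ⟨?_, ?_⟩, ⟨?_, ?_⟩, rfl⟩
  · rw [hL]
    refine ⟨x + Pi.single 0 1, ?_, ?_⟩
    · simp only [Pi.add_apply, add_mul, Finset.sum_add_distrib, Pi.single_apply, ite_mul,
        zero_mul, one_mul, Finset.sum_ite_eq', Finset.mem_univ, if_true]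
      omega
    · simp [add_mul, Finset.sum_add_distrib, Pi.single_apply]
  · rw [hL]
    rintro _ ⟨z', hz', rfl⟩
    obtain ⟨y', hy', hle⟩ := key z' hz'
    have hy'S : n - r 0 = ∑ i, y' i * r i := by omega
    linarith [hmax y' hy'S]
  · rw [hL]
    exact ⟨x, hx, rfl⟩
  · rw [hL]
    rintro _ ⟨z', hz', rfl⟩
    exact hmax z' hz'
end

section
/- Suppose the weight vector w has all entries in ℤ_{≥1} and satisfies r₁ ≤_w r₂ ≤_w ⋯ ≤_w r_k, and fix an integer w₀ ≥ 1. If n ∈ S and a ∈ Z_S(n) satisfies a₁ + ⋯ + a_k ≥ w₀r₁, then there exists a factorization b ∈ Z_S(n) with b₁ > 0 such that |b|_w − |a|_w is a nonnegative integer multiple of w₀. -/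
open Finset

/-- Below any `a : ι → ℕ` there is a monotone sequence of vectors adding one unit at a time. -/
theorem exists_monotone_le_sum_eq {ι : Type*} [Fintype ι] (a : ι → ℕ) :
    ∃ p : ℕ → ι → ℕ, Monotone p ∧ (∀ j, p j ≤ a) ∧ ∀ j ≤ ∑ i, a i, ∑ i, p j i = j := by
  classical
  have step : ∀ q : {q : ι → ℕ // q ≤ a}, ∃ q' : {q : ι → ℕ // q ≤ a},
      q ≤ q' ∧ (∑ i, q.1 i < ∑ i, a i → ∑ i, q'.1 i = ∑ i, q.1 i + 1) := by
    rintro ⟨q, hq⟩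
    by_cases h : ∑ i, q i < ∑ i, a i
    · obtain ⟨i, -, hi⟩ := Finset.exists_lt_of_sum_lt h
      refine ⟨⟨q + Pi.single i 1, fun l => ?_⟩, ?_, fun _ => ?_⟩
      · by_cases hl : l = i
        · subst hl
          simpa using hi
        · simpa [hl] using hq l
      · exact fun l => Nat.le_add_right _ _
      · simp [Finset.sum_add_distrib]
    · exact ⟨⟨q, hq⟩, le_rfl, fun h' => absurd h' h⟩
  choose f hle hsum using step
  let p : ℕ → {q : ι → ℕ // q ≤ a} := fun j => f^[j] ⟨0, fun _ => Nat.zero_le _⟩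
  have hp : ∀ j, p (j + 1) = f (p j) := fun j => Function.iterate_succ_apply' _ _ _
  refine ⟨fun j => (p j).1, monotone_nat_of_le_succ fun j => ?_, fun j => (p j).2, fun j => ?_⟩
  · rw [hp]
    exact hle (p j)
  · induction j with
    | zero => intro _; simp [p]
    | succ j ih =>
      intro hj
      have h := ih (by omega)
      beta_reduce at h ⊢
      rw [hp, hsum _ (by omega), h]

/-- A vector `a` with at least `s * t` units dominates a nonzero vector `c` whose image under
`(r, w)` lies in the lattice generated by `(s, v)` and `(0, t)`. -/
theorem exists_le_sum_mul_eq_and_dvd {ι : Type*} [Fintype ι] (r w a : ι → ℕ)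
    (hr : ∀ i, 0 < r i) {s t : ℕ} (v : ℕ) (hs : 0 < s) (ht : 0 < t) (hbig : t * s ≤ ∑ i, a i) :
    ∃ c ≤ a, ∃ m, 0 < m ∧ ∑ i, c i * r i = m * s ∧
      (t : ℤ) ∣ (m * v : ℤ) - ∑ i, (c i : ℤ) * w i := by
  obtain ⟨p, hmono, hpa, hpsum⟩ := exists_monotone_le_sum_eq a
  let R : ℕ → ℕ := fun j => ∑ i, p j i * r i
  let W : ℕ → ℤ := fun j => ∑ i, (p j i : ℤ) * w i
  let g : ℕ → ℕ × ℤ := fun j => (R j % s, (W j - (R j / s : ℕ) * v) % t)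
  have hmaps : ∀ j ∈ Finset.range (t * s + 1), g j ∈ Finset.range s ×ˢ Finset.Ico (0 : ℤ) t := by
    intro j _
    have ht' : (0 : ℤ) < t := by exact_mod_cast ht
    simp only [g, Finset.mem_product, Finset.mem_range, Finset.mem_Ico]
    exact ⟨Nat.mod_lt _ hs, Int.emod_nonneg _ ht'.ne', Int.emod_lt_of_pos _ ht'⟩
  have hcard : (Finset.range s ×ˢ Finset.Ico (0 : ℤ) t).card < (Finset.range (t * s + 1)).card := by
    simp [mul_comm]
  obtain ⟨x, hx, y, hy, hxy, hg⟩ := Finset.exists_ne_map_eq_of_card_lt_of_maps_to hcard hmaps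
  wlog hlt : x < y generalizing x y
  · exact this y hy x hx hxy.symm hg.symm (by omega)
  simp only [Finset.mem_range] at hx hy
  simp only [g, Prod.mk.injEq] at hg
  obtain ⟨hg1, hg2⟩ := hg
  have hle : ∀ i, p x i ≤ p y i := hmono hlt.le
  have hR : R x < R y := by
    refine Finset.sum_lt_sum (fun i _ => Nat.mul_le_mul_right _ (hle i)) ?_
    have hsum : ∑ i, p x i < ∑ i, p y i := by
      rw [hpsum x (by omega), hpsum y (by omega)]
      exact hlt
    obtain ⟨i, hi, h⟩ := Finset.exists_lt_of_sum_lt hsum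
    exact ⟨i, hi, Nat.mul_lt_mul_of_pos_right h (hr i)⟩
  have hx' := Nat.div_add_mod (R x) s
  have hy' := Nat.div_add_mod (R y) s
  have hdiv : R x / s < R y / s := by
    by_contra! h
    have := Nat.mul_le_mul_left s h
    omega
  have hcR : ∑ i, (p y i - p x i) * r i + R x = R y := by
    simp only [R, ← Finset.sum_add_distrib]
    exact Finset.sum_congr rfl fun i _ => by rw [← add_mul, Nat.sub_add_cancel (hle i)]
  have hcW : ∑ i, ((p y i - p x i : ℕ) : ℤ) * w i = W y - W x := by
    simp only [W, ← Finset.sum_sub_distrib]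
    exact Finset.sum_congr rfl fun i _ => by rw [Nat.cast_sub (hle i), sub_mul]
  refine ⟨fun i => p y i - p x i, fun i => (Nat.sub_le _ _).trans (hpa y i),
    R y / s - R x / s, by omega, ?_, ?_⟩
  · have h : (R y / s - R x / s) * s + s * (R x / s) = s * (R y / s) := by
      rw [mul_comm s, mul_comm s, ← add_mul, Nat.sub_add_cancel hdiv.le]
    beta_reduce
    omega
  · rw [hcW, Nat.cast_sub hdiv.le]
    convert Int.ModEq.dvd (n := (t : ℤ)) hg2.symm using 1
    ring

/-- Corollary (weighted length, integer weights, part (a)): with weights `w i ∈ ℤ_{≥1}`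
and `w₀ ≥ 1`, if a factorization `a` of `n` has total length at least `w₀·r₁`, then some
factorization `b` of `n` has positive first coordinate and `|b|_w − |a|_w ∈ w₀·ℤ_{≥0}`. -/
theorem stmt_4 (k : ℕ) (hk : 1 ≤ k) (r : Fin (k+1) → ℕ) (hr : ∀ i, 0 < r i)
    (w : Fin (k+1) → ℕ) (hw : ∀ i, 1 ≤ w i)
    (hsort : ∀ i j : Fin (k+1), i ≤ j → (w j : ℚ) / (r j : ℚ) ≤ (w i : ℚ) / (r i : ℚ))
    (w₀ : ℕ) (hw₀ : 1 ≤ w₀)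
    (n : ℕ) (a : Fin (k+1) → ℕ)
    (ha : n = ∑ i, a i * r i)
    (hbig : w₀ * r 0 ≤ ∑ i, a i) :
    ∃ b : Fin (k+1) → ℕ, n = ∑ i, b i * r i ∧ 0 < b 0 ∧
      ∃ c : ℕ, ∑ i, b i * w i = ∑ i, a i * w i + c * w₀ := by
  obtain ⟨c, hca, m, hm, hcr, hdvd⟩ :=
    exists_le_sum_mul_eq_and_dvd r w a hr (w 0) (hr 0) hw₀ hbig
  have hratio : ∀ i, w i * r 0 ≤ w 0 * r i := by
    intro i
    have h := hsort 0 i (Fin.zero_le i)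
    rw [div_le_div_iff₀ (by exact_mod_cast hr i) (by exact_mod_cast hr 0)] at h
    exact_mod_cast h
  have hcw : ∑ i, c i * w i ≤ m * w 0 := by
    refine Nat.le_of_mul_le_mul_right ?_ (hr 0)
    calc (∑ i, c i * w i) * r 0 = ∑ i, c i * (w i * r 0) := by
          simp only [Finset.sum_mul, mul_assoc]
      _ ≤ ∑ i, c i * (w 0 * r i) :=
          Finset.sum_le_sum fun i _ => Nat.mul_le_mul_left _ (hratio i)
      _ = w 0 * ∑ i, c i * r i := by
          rw [Finset.mul_sum]
          exact Finset.sum_congr rfl fun i _ => by ring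
      _ = m * w 0 * r 0 := by rw [hcr]; ring
  have hsum : ∀ u : Fin (k + 1) → ℕ,
      ∑ i, (a i - c i + (Pi.single 0 m : Fin (k + 1) → ℕ) i) * u i + ∑ i, c i * u i
        = ∑ i, a i * u i + m * u 0 := by
    intro u
    have h0 : ∑ i, (Pi.single 0 m : Fin (k + 1) → ℕ) i * u i = m * u 0 := by
      simp [Pi.single_apply]
    rw [← h0, ← Finset.sum_add_distrib, ← Finset.sum_add_distrib]
    refine Finset.sum_congr rfl fun i _ => ?_
    rw [← add_mul, ← add_mul, add_right_comm, Nat.sub_add_cancel (hca i)]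
  refine ⟨fun i => a i - c i + (Pi.single 0 m : Fin (k + 1) → ℕ) i, ?_, ?_, ?_⟩
  · have := hsum r
    beta_reduce
    omega
  · simp only [Pi.single_eq_same]
    omega
  · have hd : w₀ ∣ m * w 0 - ∑ i, c i * w i := by
      rw [← Int.natCast_dvd_natCast, Nat.cast_sub hcw]
      exact_mod_cast hdvd
    obtain ⟨q, hq⟩ := hd
    refine ⟨q, ?_⟩
    have := hsum w
    beta_reduce
    rw [mul_comm q]
    omega
end

section
/- Suppose the weight vector w has all entries in ℤ_{≥1} and satisfies r₁ ≤_w r₂ ≤_w ⋯ ≤_w r_k, and fix an integer w₀ ≥ 1. If n ∈ S and a ∈ Z_S(n) satisfies a₁ + ⋯ + a_k ≥ w₀r_k, then there exists a factorization b ∈ Z_S(n) with b_k > 0 such that |a|_w − |b|_w is a nonnegative integer multiple of w₀. -/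
open Finset

/-- Below a vector of naturals with total at least `N` there is a chain whose `j`-th term
has total `j`, for all `j ≤ N`. -/
theorem exists_monotone_chain_sum_eq {ι : Type*} [Fintype ι] (a : ι → ℕ) (N : ℕ)
    (hN : N ≤ ∑ i, a i) :
    ∃ p : ℕ → ι → ℕ, Monotone p ∧ (∀ j, p j ≤ a) ∧ ∀ j ≤ N, ∑ i, p j i = j := by
  classical
  induction N with
  | zero => exact ⟨fun _ => 0, monotone_const, fun j i => Nat.zero_le _, by simp⟩
  | succ N ih =>
    obtain ⟨p, hmono, hle, hsum⟩ := ih (by omega)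
    obtain ⟨i₀, -, hi₀⟩ : ∃ i ∈ univ, p N i < a i :=
      exists_lt_of_sum_lt (by rw [hsum N le_rfl]; omega)
    refine ⟨fun j => if j ≤ N then p j else p N + Pi.single i₀ 1, ?_, ?_, ?_⟩
    · intro j l hjl
      dsimp only
      split_ifs with h1 h2 h2
      · exact hmono hjl
      · exact (hmono h1).trans (fun i => Nat.le_add_right _ _)
      · omega
      · exact le_rfl
    · intro j
      dsimp only
      split_ifs with h1
      · exact hle j
      · intro i
        by_cases h : i = i₀
        · subst h
          simpa using hi₀
        · simpa [h] using hle N i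
    · intro j hj
      dsimp only
      split_ifs with h1
      · exact hsum j h1
      · simp only [Pi.add_apply, sum_add_distrib, hsum N le_rfl, sum_pi_single', mem_univ, if_true]
        omega

/-- A zero-sum statement in the group `ℤ² / ⟨(d, u), (0, e)⟩` of order `e * d`: a multiset of at
least `e * d` vectors `(r i, w i)`, with multiplicities `a i`, has a nonempty zero-sum
sub-multiset. -/
theorem exists_le_sum_mul_eq {ι : Type*} [Fintype ι] (a r w : ι → ℕ) (d u e : ℕ)
    (hd : 0 < d) (he : 0 < e) (hbig : e * d ≤ ∑ i, a i) :
    ∃ c : ι → ℕ, c ≤ a ∧ 0 < ∑ i, c i ∧ ∃ m t : ℤ,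
      ∑ i, (c i : ℤ) * r i = m * d ∧ ∑ i, (c i : ℤ) * w i = m * u + t * e := by
  obtain ⟨p, hmono, hle, hsum⟩ := exists_monotone_chain_sum_eq a (e * d) hbig
  let R : ℕ → ℤ := fun j => ∑ i, (p j i : ℤ) * r i
  let W : ℕ → ℤ := fun j => ∑ i, (p j i : ℤ) * w i
  let f : ℕ → ℤ × ℤ := fun j => ((W j - R j / d * u) % e, R j % d)
  have hd' : (0 : ℤ) < d := by exact_mod_cast hd
  have he' : (0 : ℤ) < e := by exact_mod_cast he
  have hmaps : ∀ j ∈ range (e * d + 1), f j ∈ Ico (0 : ℤ) e ×ˢ Ico (0 : ℤ) d := by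
    intro j _
    simp only [f, mem_product, mem_Ico]
    exact ⟨⟨Int.emod_nonneg _ he'.ne', Int.emod_lt_of_pos _ he'⟩,
      ⟨Int.emod_nonneg _ hd'.ne', Int.emod_lt_of_pos _ hd'⟩⟩
  obtain ⟨x, hx, y, hy, hxy, hf⟩ := exists_ne_map_eq_of_card_lt_of_maps_to
    (by simp [card_product]) hmaps
  wlog hlt : x < y generalizing x y
  · exact this y hy x hx hxy.symm hf.symm (by omega)
  have hpxy : p x ≤ p y := hmono hlt.le
  have hcast : ∀ v : ι → ℕ, ∑ i, ((p y i - p x i : ℕ) : ℤ) * v i =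
      ∑ i, (p y i : ℤ) * v i - ∑ i, (p x i : ℤ) * v i := by
    intro v
    rw [← sum_sub_distrib]
    refine sum_congr rfl fun i _ => ?_
    rw [Nat.cast_sub (hpxy i)]
    ring
  simp only [f, Prod.mk.injEq] at hf
  obtain ⟨t, ht⟩ := Int.ModEq.dvd hf.1
  refine ⟨fun i => p y i - p x i, fun i => (Nat.sub_le _ _).trans (hle y i), ?_,
    R y / d - R x / d, t, ?_, ?_⟩
  · rw [sum_tsub_distrib _ (fun i _ => hpxy i), hsum x (by simp at hx; omega),
      hsum y (by simp at hy; omega)]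
    omega
  · rw [hcast r]
    change R y - R x = _
    linarith [Int.emod_add_mul_ediv (R y) d, Int.emod_add_mul_ediv (R x) d, hf.2]
  · rw [hcast w]
    change W y - W x = _
    linarith

/-- Corollary (weighted length, integer weights, part (b)): with weights `w i ∈ ℤ_{≥1}`
and `w₀ ≥ 1`, if a factorization `a` of `n` has total length at least `w₀·r_k`, then some
factorization `b` of `n` has positive last coordinate and `|a|_w − |b|_w ∈ w₀·ℤ_{≥0}`. -/
theorem stmt_5 (k : ℕ) (hk : 1 ≤ k) (r : Fin (k+1) → ℕ) (hr : ∀ i, 0 < r i)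
    (w : Fin (k+1) → ℕ) (hw : ∀ i, 1 ≤ w i)
    (hsort : ∀ i j : Fin (k+1), i ≤ j → (w j : ℚ) / (r j : ℚ) ≤ (w i : ℚ) / (r i : ℚ))
    (w₀ : ℕ) (hw₀ : 1 ≤ w₀)
    (n : ℕ) (a : Fin (k+1) → ℕ)
    (ha : n = ∑ i, a i * r i)
    (hbig : w₀ * r (Fin.last k) ≤ ∑ i, a i) :
    ∃ b : Fin (k+1) → ℕ, n = ∑ i, b i * r i ∧ 0 < b (Fin.last k) ∧
      ∃ c : ℕ, ∑ i, a i * w i = ∑ i, b i * w i + c * w₀ := by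
  have hd := hr (Fin.last k)
  obtain ⟨c, hca, hcpos, m, t, hm, ht⟩ :=
    exists_le_sum_mul_eq a r w (r (Fin.last k)) (w (Fin.last k)) w₀ hd hw₀ hbig
  have hd' : (0 : ℤ) < r (Fin.last k) := by exact_mod_cast hd
  have hcr : (0 : ℤ) < ∑ i, (c i : ℤ) * r i := by
    have h : ∑ i, c i ≤ ∑ i, c i * r i :=
      sum_le_sum fun i _ => Nat.le_mul_of_pos_right _ (hr i)
    exact_mod_cast hcpos.trans_le h
  have hmpos : 0 < m := pos_of_mul_pos_left (hm ▸ hcr) hd'.le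
  have hcross : ∀ i, (w (Fin.last k) : ℤ) * r i ≤ w i * r (Fin.last k) := by
    intro i
    have h := hsort i (Fin.last k) (Fin.le_last i)
    rw [div_le_div_iff₀ (by exact_mod_cast hd) (by exact_mod_cast hr i)] at h
    exact_mod_cast h
  have htnonneg : 0 ≤ t := by
    have h : (w (Fin.last k) : ℤ) * ∑ i, (c i : ℤ) * r i ≤
        (∑ i, (c i : ℤ) * w i) * r (Fin.last k) := by
      rw [mul_sum, sum_mul]
      refine sum_le_sum fun i _ => ?_
      nlinarith [mul_le_mul_of_nonneg_left (hcross i) (Int.natCast_nonneg (c i))]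
    rw [hm, ht] at h
    have h' : 0 ≤ t * (w₀ * r (Fin.last k) : ℤ) := by linarith
    exact nonneg_of_mul_nonneg_left h' (by positivity)
  lift m to ℕ using hmpos.le
  lift t to ℕ using htnonneg
  have hm' : ∑ i, c i * r i = m * r (Fin.last k) := by exact_mod_cast hm
  have ht' : ∑ i, c i * w i = m * w (Fin.last k) + t * w₀ := by exact_mod_cast ht
  have hb : ∀ v : Fin (k+1) → ℕ,
      ∑ i, (a i - c i + (Pi.single (Fin.last k) m : Fin (k+1) → ℕ) i) * v i + ∑ i, c i * v i =
        ∑ i, a i * v i + m * v (Fin.last k) := by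
    intro v
    have hs : ∑ i, (Pi.single (Fin.last k) m : Fin (k+1) → ℕ) i * v i = m * v (Fin.last k) := by
      simp [Pi.single_apply]
    rw [← hs, ← sum_add_distrib, ← sum_add_distrib]
    refine sum_congr rfl fun i _ => ?_
    rw [← add_mul, ← add_mul]
    congr 1
    have : c i ≤ a i := hca i
    omega
  refine ⟨fun i => a i - c i + (Pi.single (Fin.last k) m : Fin (k+1) → ℕ) i, ?_, ?_, t, ?_⟩
  · have := hb r
    dsimp only
    omega
  · have : 0 < m := by exact_mod_cast hmpos
    simp [this]
  · have := hb w
    dsimp only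
    omega
end

section
/- If the weighted delta set Δ_w(S) is nonempty, then it has a minimum element d, and every element of Δ_w(S) is a positive integer multiple of d. -/
/-- Finitely many rationals have a common positive denominator. -/
theorem exists_common_denominator {ι : Type*} [Fintype ι] (w : ι → ℚ) :
    ∃ D : ℕ, 0 < D ∧ ∃ W : ι → ℤ, ∀ i, (W i : ℚ) = D * w i := by
  classical
  refine ⟨∏ i, (w i).den, Finset.prod_pos fun i _ => (w i).den_pos,
    fun i => (∏ j ∈ Finset.univ.erase i, ((w j).den : ℤ)) * (w i).num, fun i => ?_⟩
  rw [← Finset.mul_prod_erase _ _ (Finset.mem_univ i)]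
  push_cast
  rw [← Rat.mul_den_eq_num (w i)]
  ring

/-- The rational weights of the integer relations among the `r i` are exactly the integer
multiples of a single nonnegative rational. -/
theorem exists_generator_relation_weights {ι : Type*} [Fintype ι] (r : ι → ℕ) (w : ι → ℚ) :
    ∃ g : ℚ, 0 ≤ g ∧ (∃ v : ι → ℤ, ∑ i, v i * r i = 0 ∧ ∑ i, (v i : ℚ) * w i = g) ∧
      ∀ v : ι → ℤ, ∑ i, v i * r i = 0 → ∃ c : ℤ, ∑ i, (v i : ℚ) * w i = c * g := by
  obtain ⟨D, hD, W, hW⟩ := exists_common_denominator w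
  have hD' : (D : ℚ) ≠ 0 := by positivity
  have hsum : ∀ v : ι → ℤ, ∑ i, (v i : ℚ) * w i = ((∑ i, v i * W i : ℤ) : ℚ) / D := by
    intro v
    rw [eq_div_iff hD', Finset.sum_mul]
    push_cast
    refine Finset.sum_congr rfl fun i _ => ?_
    rw [hW]
    ring
  let H : AddSubgroup ℤ :=
    { carrier := {n | ∃ v : ι → ℤ, ∑ i, v i * r i = 0 ∧ ∑ i, v i * W i = n}
      zero_mem' := ⟨0, by simp, by simp⟩
      add_mem' := by
        rintro _ _ ⟨u, hu, rfl⟩ ⟨v, hv, rfl⟩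
        refine ⟨u + v, ?_, ?_⟩
        · simp [add_mul, Finset.sum_add_distrib, hu, hv]
        · simp [add_mul, Finset.sum_add_distrib]
      neg_mem' := by
        rintro _ ⟨v, hv, rfl⟩
        exact ⟨-v, by simp [hv], by simp⟩ }
  obtain ⟨a, ha⟩ := Int.subgroup_cyclic H
  rw [← AddSubgroup.zmultiples_eq_closure] at ha
  have hmem : |a| ∈ H := by
    rw [ha, Int.mem_zmultiples_iff]
    exact (dvd_abs a a).mpr dvd_rfl
  obtain ⟨v, hv, hva⟩ := hmem
  refine ⟨(|a| : ℤ) / D, by positivity, ⟨v, hv, by rw [hsum, hva]⟩, fun u hu => ?_⟩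
  have hu' : ∑ i, u i * W i ∈ H := ⟨u, hu, rfl⟩
  rw [ha, Int.mem_zmultiples_iff, ← abs_dvd] at hu'
  obtain ⟨c, hc⟩ := hu'
  refine ⟨c, ?_⟩
  rw [hsum, hc]
  push_cast
  ring

/-- Theorem (weighted delta set, part (a)): if the weighted delta set `Δ_w(S)` is
nonempty, then it has a minimum element `d`, and every element of `Δ_w(S)` is a
positive integer multiple of `d`.  Here `L N` is the weighted length set of `N`,
`Δn N` is the set of gaps between consecutive elements of `L N`, and `ΔS` is the
union of the `Δn N` over all `N ∈ S`. -/
theorem stmt_6 (k : ℕ) (hk : 1 ≤ k) (r : Fin (k+1) → ℕ) (hr : ∀ i, 0 < r i)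
    (w : Fin (k+1) → ℚ)
    (L : ℕ → Set ℚ)
    (hL : ∀ N : ℕ, L N = {q | ∃ z : Fin (k+1) → ℕ,
      N = ∑ i, z i * r i ∧ q = ∑ i, (z i : ℚ) * w i})
    (Δn : ℕ → Set ℚ)
    (hΔn : ∀ N : ℕ, Δn N = {d | ∃ ℓ ℓ' : ℚ, ℓ ∈ L N ∧ ℓ' ∈ L N ∧ ℓ < ℓ' ∧
      (∀ x ∈ L N, ¬(ℓ < x ∧ x < ℓ')) ∧ d = ℓ' - ℓ})
    (ΔS : Set ℚ)
    (hΔS : ΔS = {d | ∃ N : ℕ, (∃ z : Fin (k+1) → ℕ, N = ∑ i, z i * r i) ∧ d ∈ Δn N})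
    (hne : ΔS.Nonempty) :
    ∃ d : ℚ, IsLeast ΔS d ∧ ∀ x ∈ ΔS, ∃ c : ℕ, 0 < c ∧ x = (c : ℚ) * d := by
  obtain ⟨g, hg0, ⟨v, hv, hvg⟩, hg⟩ := exists_generator_relation_weights r w
  have hdiff : ∀ N, ∀ x ∈ L N, ∀ y ∈ L N, ∃ c : ℤ, y - x = c * g := by
    intro N x hx y hy
    rw [hL] at hx hy
    obtain ⟨a, ha, rfl⟩ := hx
    obtain ⟨b, hb, rfl⟩ := hy
    have hab : (∑ i, (b i : ℤ) * r i) = ∑ i, (a i : ℤ) * r i := by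
      exact_mod_cast hb.symm.trans ha
    obtain ⟨c, hc⟩ := hg (fun i => (b i : ℤ) - a i) (by
      simp [sub_mul, Finset.sum_sub_distrib, hab])
    refine ⟨c, ?_⟩
    rw [← hc]
    simp [sub_mul, Finset.sum_sub_distrib]
  have hmul : ∀ x ∈ ΔS, ∃ c : ℕ, 0 < c ∧ x = (c : ℚ) * g := by
    intro x hx
    rw [hΔS] at hx
    obtain ⟨N, -, hx⟩ := hx
    rw [hΔn] at hx
    obtain ⟨l, l', hl, hl', hlt, -, rfl⟩ := hx
    obtain ⟨c, hc⟩ := hdiff N l hl l' hl'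
    have hcpos : (0 : ℚ) < c := pos_of_mul_pos_left (hc ▸ sub_pos.mpr hlt) hg0
    lift c to ℕ using by exact_mod_cast hcpos.le
    exact ⟨c, by exact_mod_cast hcpos, by simpa using hc⟩
  have hgpos : 0 < g := by
    refine hg0.lt_of_ne' fun h => ?_
    obtain ⟨x, hx⟩ := hne
    rw [hΔS] at hx
    obtain ⟨N, -, hx⟩ := hx
    rw [hΔn] at hx
    obtain ⟨l, l', hl, hl', hlt, -, -⟩ := hx
    obtain ⟨c, hc⟩ := hdiff N l hl l' hl'
    rw [h, mul_zero] at hc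
    linarith
  have hparts : ∀ i, ((v i).toNat : ℤ) - ((-v i).toNat : ℤ) = v i := fun i => by omega
  have hN : ∑ i, (v i).toNat * r i = ∑ i, (-v i).toNat * r i := by
    zify
    rw [← sub_eq_zero, ← Finset.sum_sub_distrib, ← hv]
    exact Finset.sum_congr rfl fun i _ => by rw [← sub_mul, hparts]
  have hlen : ∑ i, ((v i).toNat : ℚ) * w i = ∑ i, ((-v i).toNat : ℚ) * w i + g := by
    rw [← hvg, ← Finset.sum_add_distrib]
    refine Finset.sum_congr rfl fun i _ => ?_
    have h : ((v i).toNat : ℚ) - ((-v i).toNat : ℚ) = v i := by exact_mod_cast hparts i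
    rw [← h]
    ring
  refine ⟨g, ⟨?_, fun x hx => ?_⟩, hmul⟩
  · rw [hΔS]
    refine ⟨∑ i, (v i).toNat * r i, ⟨_, rfl⟩, ?_⟩
    have hlow : ∑ i, ((-v i).toNat : ℚ) * w i ∈ L (∑ i, (v i).toNat * r i) := by
      rw [hL]
      exact ⟨_, hN, rfl⟩
    rw [hΔn]
    refine ⟨_, ∑ i, ((v i).toNat : ℚ) * w i, hlow, ?_, ?_, ?_, ?_⟩
    · rw [hL]
      exact ⟨_, rfl, rfl⟩
    · linarith
    · rintro x hx ⟨h1, h2⟩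
      obtain ⟨c, hc⟩ := hdiff _ _ hlow x hx
      have hc0 : (0 : ℚ) < c := pos_of_mul_pos_left (hc ▸ sub_pos.mpr h1) hg0
      have hc1 : (c : ℚ) < 1 := by
        refine lt_of_mul_lt_mul_right ?_ hg0
        linarith
      norm_cast at hc0 hc1
      omega
    · linarith
  · obtain ⟨c, hc, rfl⟩ := hmul x hx
    exact le_mul_of_one_le_left hg0 (by exact_mod_cast hc)
end

section
/- The weighted delta set Δ_w(S) is a finite set; moreover, if Δ_w(S) is nonempty, then its maximum equals the maximum of the set ⋃_{β ∈ Betti(S)} Δ_{S,w}(β), i.e., max Δ_w(S) = max_{β ∈ Betti(S)} max Δ_{S,w}(β). -/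
open Finset

namespace WeightedDelta

variable {ι : Type*} [Fintype ι]

/-- The set of weighted lengths of the factorizations of `N`. -/
def lengthSet (r : ι → ℕ) (w : ι → ℚ) (N : ℕ) : Set ℚ :=
  {q | ∃ z : ι → ℕ, N = ∑ i, z i * r i ∧ q = ∑ i, (z i : ℚ) * w i}

/-- The set of gaps between consecutive elements of a set of rationals. -/
def gapSet (L : Set ℚ) : Set ℚ :=
  {d | ∃ ℓ ℓ' : ℚ, ℓ ∈ L ∧ ℓ' ∈ L ∧ ℓ < ℓ' ∧ (∀ x ∈ L, ¬(ℓ < x ∧ x < ℓ')) ∧ d = ℓ' - ℓ}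

/-- Adjacency in the factorization graph of `N`. -/
def FactorAdj (r : ι → ℕ) (N : ℕ) (x y : ι → ℕ) : Prop :=
  (N = ∑ i, x i * r i) ∧ (N = ∑ i, y i * r i) ∧ ∃ t, x t ≠ 0 ∧ y t ≠ 0

/-- The elements whose factorization graph is disconnected. -/
def bettiSet (r : ι → ℕ) : Set ℕ :=
  {β | ∃ z z' : ι → ℕ, β = ∑ i, z i * r i ∧ β = ∑ i, z' i * r i ∧
    ¬ Relation.ReflTransGen (FactorAdj r β) z z'}

lemma sum_add_single [DecidableEq ι] {R : Type*} [CommSemiring R] (z : ι → ℕ) (t : ι) (n : ℕ)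
    (f : ι → R) :
    ∑ i, (((z + Pi.single t n : ι → ℕ) i : ℕ) : R) * f i = ∑ i, (z i : R) * f i + n * f t := by
  simp [add_mul, Finset.sum_add_distrib, Pi.single_apply]

lemma exists_eq_add_single {α : Type*} [DecidableEq α] {z : α → ℕ} {t : α} {n : ℕ}
    (h : n ≤ z t) : ∃ y : α → ℕ, z = y + Pi.single t n :=
  ⟨z - Pi.single t n, (tsub_add_cancel_of_le (by
    intro i
    by_cases hi : i = t
    · subst hi; simpa using h
    · simp [hi])).symm⟩

lemma finite_lengthSet {r : ι → ℕ} (hr : ∀ i, 0 < r i) (w : ι → ℚ) (N : ℕ) :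
    (lengthSet r w N).Finite := by
  classical
  refine ((Set.finite_Icc (0 : ι → ℕ) (fun _ => N)).image
    (fun z : ι → ℕ => ∑ i, (z i : ℚ) * w i)).subset ?_
  rintro q ⟨z, hz, rfl⟩
  refine ⟨z, ⟨zero_le, fun i => ?_⟩, rfl⟩
  calc z i ≤ z i * r i := Nat.le_mul_of_pos_right _ (hr i)
    _ ≤ ∑ j, z j * r j :=
      Finset.single_le_sum (f := fun j => z j * r j) (fun _ _ => Nat.zero_le _) (Finset.mem_univ i)
    _ = N := hz.symm

lemma finite_gapSet {L : Set ℚ} (hL : L.Finite) : (gapSet L).Finite := by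
  refine (Set.Finite.image2 (fun a b => b - a) hL hL).subset ?_
  rintro d ⟨a, b, ha, hb, -, -, rfl⟩
  exact ⟨a, ha, b, hb, rfl⟩

/-- A coordinate exceeding every generator makes a factorization reach all others. -/
lemma reflTransGen_of_large [DecidableEq ι] {r : ι → ℕ} (hr : ∀ i, 0 < r i) {N : ℕ}
    {z z' : ι → ℕ} (hz : N = ∑ i, z i * r i) (hz' : N = ∑ i, z' i * r i) {i : ι}
    (hi : ∀ j, r j < z i) : Relation.ReflTransGen (FactorAdj r N) z z' := by
  have hN : N ≠ 0 := by
    have h1 : z i * r i ≤ ∑ j, z j * r j :=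
      Finset.single_le_sum (f := fun j => z j * r j) (fun _ _ => Nat.zero_le _) (Finset.mem_univ i)
    have h2 := Nat.mul_pos ((hr i).trans (hi i)) (hr i)
    omega
  obtain ⟨j, hj⟩ : ∃ j, z' j ≠ 0 := by
    by_contra! h
    simp [h] at hz'
    exact hN hz'
  obtain ⟨y, rfl⟩ := exists_eq_add_single (hi j).le
  have hy : N = ∑ l, (y + Pi.single j (r i) : ι → ℕ) l * r l := by
    have h1 := sum_add_single y i (r j) r
    have h2 := sum_add_single y j (r i) r
    simp only [Nat.cast_id] at h1 h2
    rw [hz, h1, h2, mul_comm]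
  have hyi : y i ≠ 0 := by
    have := hi j
    simp at this
    omega
  have hzi : (y + Pi.single i (r j) : ι → ℕ) i ≠ 0 := by simp [hyi]
  have hyi' : (y + Pi.single j (r i) : ι → ℕ) i ≠ 0 := by simp [hyi]
  have hyj : (y + Pi.single j (r i) : ι → ℕ) j ≠ 0 := by simp [(hr i).ne']
  exact (Relation.ReflTransGen.single ⟨hz, hy, i, hzi, hyi'⟩).tail ⟨hy, hz', j, hyj, hj⟩

lemma finite_bettiSet {r : ι → ℕ} (hr : ∀ i, 0 < r i) : (bettiSet r).Finite := by
  classical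
  refine (Set.finite_Iic (∑ i, (∑ j, r j) * r i)).subset ?_
  rintro β ⟨z, z', hz, hz', h⟩
  rw [Set.mem_Iic, hz]
  refine Finset.sum_le_sum fun i _ => Nat.mul_le_mul_right _ ?_
  by_contra! hi
  exact h (reflTransGen_of_large hr hz hz' (i := i) fun j =>
    (Finset.single_le_sum (fun _ _ => Nat.zero_le _) (Finset.mem_univ j)).trans_lt hi)

/-- A finite set with gaps at most `B` crosses each intermediate value by a step at most `B`. -/
lemma exists_crossing_of_gapSet_le {L : Set ℚ} (hL : L.Finite) {B : ℚ}
    (hB : ∀ d ∈ gapSet L, d ≤ B) {a b c : ℚ} (ha : a ∈ L) (hb : b ∈ L) (hac : a ≤ c)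
    (hcb : c < b) : ∃ x ∈ L, ∃ y ∈ L, x ≤ c ∧ c < y ∧ y - x ≤ B := by
  obtain ⟨x, ⟨hx, hxc⟩, hmax⟩ := Set.exists_max_image (L ∩ Set.Iic c) id
    (hL.subset Set.inter_subset_left) ⟨a, ha, hac⟩
  obtain ⟨y, ⟨hy, hcy⟩, hmin⟩ := Set.exists_min_image (L ∩ Set.Ioi c) id
    (hL.subset Set.inter_subset_left) ⟨b, hb, hcb⟩
  refine ⟨x, hx, y, hy, hxc, hcy, hB _ ⟨x, y, hx, hy, lt_of_le_of_lt hxc hcy, ?_, rfl⟩⟩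
  rintro u hu ⟨hxu, huy⟩
  rcases le_or_gt u c with huc | huc
  · exact (hmax u ⟨hu, huc⟩).not_gt hxu
  · exact (hmin u ⟨hu, huc⟩).not_gt huy

lemma exists_step_crossing {α : Type*} {R : α → α → Prop} {f : α → ℚ} {c : ℚ} {a b : α}
    (h : Relation.ReflTransGen R a b) (ha : f a ≤ c) (hb : c < f b) :
    ∃ x y, R x y ∧ f x ≤ c ∧ c < f y := by
  induction h with
  | refl => exact absurd hb ha.not_gt
  | @tail u v _ huv ih =>
    rcases le_or_gt (f u) c with hu | hu
    · exact ⟨u, v, huv, hu, hb⟩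
    · exact ih hu

lemma exists_crossing {r : ι → ℕ} (hr : ∀ i, 0 < r i) (w : ι → ℚ) {B : ℚ}
    (hB : ∀ β ∈ bettiSet r, ∀ d ∈ gapSet (lengthSet r w β), d ≤ B) (N : ℕ) {a b c : ℚ}
    (ha : a ∈ lengthSet r w N) (hb : b ∈ lengthSet r w N) (hac : a ≤ c) (hcb : c < b) :
    ∃ x ∈ lengthSet r w N, ∃ y ∈ lengthSet r w N, x ≤ c ∧ c < y ∧ y - x ≤ B := by
  classical
  induction N using Nat.strong_induction_on generalizing a b c with
  | _ N ih =>
  by_cases hN : N ∈ bettiSet r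
  · exact exists_crossing_of_gapSet_le (finite_lengthSet hr w N) (hB N hN) ha hb hac hcb
  obtain ⟨z, hz, rfl⟩ := ha
  obtain ⟨z', hz', rfl⟩ := hb
  have hconn : Relation.ReflTransGen (FactorAdj r N) z z' := by
    by_contra h
    exact hN ⟨z, z', hz, hz', h⟩
  obtain ⟨u, v, ⟨hu, hv, t, hut, hvt⟩, huc, hcv⟩ :=
    exists_step_crossing (f := fun z : ι → ℕ => ∑ i, (z i : ℚ) * w i) hconn hac hcb
  obtain ⟨u, rfl⟩ := exists_eq_add_single (Nat.one_le_iff_ne_zero.2 hut)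
  obtain ⟨v, rfl⟩ := exists_eq_add_single (Nat.one_le_iff_ne_zero.2 hvt)
  have hsum (y : ι → ℕ) : ∑ i, (y + Pi.single t 1 : ι → ℕ) i * r i = ∑ i, y i * r i + r t := by
    simpa using sum_add_single y t 1 r
  have hlen (y : ι → ℕ) : ∑ i, (((y + Pi.single t 1 : ι → ℕ) i : ℕ) : ℚ) * w i
      = ∑ i, (y i : ℚ) * w i + w t := by
    simpa using sum_add_single y t 1 w
  rw [hsum] at hu hv
  simp only [hlen] at huc hcv
  have hrt := hr t
  obtain ⟨_, ⟨x, hx, rfl⟩, _, ⟨y, hy, rfl⟩, hxc, hcy, hxy⟩ :=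
    ih (N - r t) (by omega) (c := c - w t) ⟨u, by omega, rfl⟩ ⟨v, by omega, rfl⟩
      (by linarith) (by linarith)
  refine ⟨_, ⟨x + Pi.single t 1, by rw [hsum]; omega, rfl⟩,
    _, ⟨y + Pi.single t 1, by rw [hsum]; omega, rfl⟩, ?_, ?_, ?_⟩ <;>
  · simp only [hlen]
    linarith

/-- A bound on the gaps at the Betti elements bounds the gaps everywhere. -/
lemma gapSet_le {r : ι → ℕ} (hr : ∀ i, 0 < r i) (w : ι → ℚ) {B : ℚ}
    (hB : ∀ β ∈ bettiSet r, ∀ d ∈ gapSet (lengthSet r w β), d ≤ B) {N : ℕ} {d : ℚ}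
    (hd : d ∈ gapSet (lengthSet r w N)) : d ≤ B := by
  obtain ⟨l, l', hl, hl', hlt, hgap, rfl⟩ := hd
  obtain ⟨x, -, y, hy, hxl, hly, hxy⟩ := exists_crossing hr w hB N hl hl' le_rfl hlt
  have : l' ≤ y := not_lt.1 fun h => hgap y hy ⟨hly, h⟩
  linarith

lemma exists_common_denominator (w : ι → ℚ) :
    ∃ D : ℕ, 0 < D ∧ ∀ i, ∃ m : ℤ, (D : ℚ) * w i = m := by
  refine ⟨∏ i, (w i).den, Finset.prod_pos fun i _ => (w i).den_pos, fun i => ?_⟩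
  obtain ⟨e, he⟩ := Finset.dvd_prod_of_mem (fun i => (w i).den) (Finset.mem_univ i)
  refine ⟨e * (w i).num, ?_⟩
  rw [he]
  push_cast
  rw [← Rat.mul_den_eq_num]
  ring

lemma finite_iUnion_gapSet (r : ι → ℕ) (w : ι → ℚ) {B : ℚ}
    (hB : ∀ N, ∀ d ∈ gapSet (lengthSet r w N), d ≤ B) :
    (⋃ N, gapSet (lengthSet r w N)).Finite := by
  obtain ⟨D, hD, hw⟩ := exists_common_denominator w
  choose m hm using hw
  have hD' : (0 : ℚ) < D := by exact_mod_cast hD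
  refine ((Set.finite_Icc (0 : ℤ) ⌊D * B⌋).image fun n : ℤ => (n : ℚ) / D).subset ?_
  intro d hd
  obtain ⟨N, hd⟩ := Set.mem_iUnion.1 hd
  have hdB := hB N d hd
  obtain ⟨_, _, ⟨z, -, rfl⟩, ⟨z', -, rfl⟩, hlt, -, rfl⟩ := hd
  have hlen (y : ι → ℕ) : (D : ℚ) * ∑ i, (y i : ℚ) * w i = ((∑ i, y i * m i : ℤ) : ℚ) := by
    rw [Finset.mul_sum]
    push_cast
    refine Finset.sum_congr rfl fun i _ => ?_
    rw [← hm]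
    ring
  have hdiff := congrArg₂ (· - ·) (hlen z') (hlen z)
  simp only [← mul_sub, ← Int.cast_sub] at hdiff
  refine ⟨∑ i, z' i * m i - ∑ i, z i * m i, ⟨?_, Int.le_floor.2 ?_⟩, ?_⟩
  · have : (0 : ℚ) ≤ ((∑ i, z' i * m i - ∑ i, z i * m i : ℤ) : ℚ) := by
      rw [← hdiff]
      exact mul_nonneg hD'.le (sub_nonneg.2 hlt.le)
    exact_mod_cast this
  · rw [← hdiff]
    exact mul_le_mul_of_nonneg_left hdB hD'.le
  · simp only [← hdiff]
    field_simp

end WeightedDelta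

/-- Theorem (weighted delta set, part (c)): `Δ_w(S)` is finite, and if it is nonempty
then `max Δ_w(S) = max_{β ∈ Betti(S)} max Δ_{S,w}(β)`.  A Betti element `β ∈ S` is one
whose factorization graph (factorizations of `β` adjacent when they share a nonzero
coordinate, connectivity taken as the reflexive-transitive closure) is disconnected. -/
theorem stmt_8 (k : ℕ) (hk : 1 ≤ k) (r : Fin (k+1) → ℕ) (hr : ∀ i, 0 < r i)
    (w : Fin (k+1) → ℚ)
    (L : ℕ → Set ℚ)
    (hL : ∀ N : ℕ, L N = {q | ∃ z : Fin (k+1) → ℕ,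
      N = ∑ i, z i * r i ∧ q = ∑ i, (z i : ℚ) * w i})
    (Δn : ℕ → Set ℚ)
    (hΔn : ∀ N : ℕ, Δn N = {d | ∃ ℓ ℓ' : ℚ, ℓ ∈ L N ∧ ℓ' ∈ L N ∧ ℓ < ℓ' ∧
      (∀ x ∈ L N, ¬(ℓ < x ∧ x < ℓ')) ∧ d = ℓ' - ℓ})
    (ΔS : Set ℚ)
    (hΔS : ΔS = {d | ∃ N : ℕ, (∃ z : Fin (k+1) → ℕ, N = ∑ i, z i * r i) ∧ d ∈ Δn N})
    (Betti : Set ℕ)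
    (hBetti : Betti = {β | (∃ z : Fin (k+1) → ℕ, β = ∑ i, z i * r i) ∧
      ∃ z z' : Fin (k+1) → ℕ, β = ∑ i, z i * r i ∧ β = ∑ i, z' i * r i ∧
        ¬ Relation.ReflTransGen (fun x y : Fin (k+1) → ℕ =>
            (β = ∑ i, x i * r i) ∧ (β = ∑ i, y i * r i) ∧ ∃ t, x t ≠ 0 ∧ y t ≠ 0)
          z z'}) :
    ΔS.Finite ∧ (ΔS.Nonempty →
      ∃ M : ℚ, IsGreatest ΔS M ∧ IsGreatest {d : ℚ | ∃ β ∈ Betti, d ∈ Δn β} M) := by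
  have hL' : L = WeightedDelta.lengthSet r w := funext hL
  have hΔ (N : ℕ) : Δn N = WeightedDelta.gapSet (WeightedDelta.lengthSet r w N) := by
    rw [hΔn, hL']
    rfl
  have hBetti' : Betti = WeightedDelta.bettiSet r := by
    rw [hBetti]
    ext β
    exact ⟨fun h => h.2, fun ⟨z, z', hz, hz', h⟩ => ⟨⟨z, hz⟩, z, z', hz, hz', h⟩⟩
  have hS : ΔS = ⋃ N, Δn N := by
    rw [hΔS]
    ext d
    simp only [Set.mem_ofPred_eq, Set.mem_iUnion]
    refine ⟨fun ⟨N, _, hd⟩ => ⟨N, hd⟩, fun ⟨N, hd⟩ => ⟨N, ?_, hd⟩⟩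
    rw [hΔ] at hd
    obtain ⟨_, _, ⟨z, hz, -⟩, -⟩ := hd
    exact ⟨z, hz⟩
  have hfin : {d : ℚ | ∃ β ∈ Betti, d ∈ Δn β}.Finite := by
    have h := (WeightedDelta.finite_bettiSet hr).biUnion fun β _ =>
      WeightedDelta.finite_gapSet (WeightedDelta.finite_lengthSet hr w β)
    refine h.subset ?_
    rintro d ⟨β, hβ, hd⟩
    rw [hΔ] at hd
    exact Set.mem_biUnion (hBetti' ▸ hβ) hd
  have hbound (B : ℚ) (hB : B ∈ upperBounds {d : ℚ | ∃ β ∈ Betti, d ∈ Δn β}) (N : ℕ) :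
      ∀ d ∈ WeightedDelta.gapSet (WeightedDelta.lengthSet r w N), d ≤ B := fun d hd =>
    WeightedDelta.gapSet_le hr w
      (fun β hβ d hd => hB ⟨β, hBetti' ▸ hβ, (hΔ β).symm ▸ hd⟩) hd
  constructor
  · obtain ⟨B, hB⟩ := hfin.bddAbove
    simpa only [hS, hΔ] using WeightedDelta.finite_iUnion_gapSet r w (hbound B hB)
  · rintro ⟨d, hd⟩
    simp only [hS, hΔ, Set.mem_iUnion] at hd
    obtain ⟨N, hd⟩ := hd
    have hne : {d : ℚ | ∃ β ∈ Betti, d ∈ Δn β}.Nonempty := by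
      by_contra hempty
      rw [Set.not_nonempty_iff_eq_empty] at hempty
      have := hbound (d - 1) (by simp [hempty]) N d hd
      linarith
    obtain ⟨M, hM, hmax⟩ := Set.exists_max_image _ id hfin hne
    refine ⟨M, ⟨?_, fun e he => ?_⟩, hM, hmax⟩
    · obtain ⟨β, -, hβ⟩ := hM
      exact hS ▸ Set.mem_iUnion.2 ⟨β, hβ⟩
    · simp only [hS, hΔ, Set.mem_iUnion] at he
      obtain ⟨N', he⟩ := he
      exact hbound M hmax N' e he
end

section
/- Suppose n > w₁²·W·R², β is a Betti element of P_n, and z, z′ ∈ Z_{P_n}(β) lie in different connected components of the factorization graph ∇_β with |z|_w > |z′|_w. Then: (a) every factorization y ∈ Z_{P_n}(β) with |y|_w = |z|_w lies in the connected component of z, and every factorization y′ ∈ Z_{P_n}(β) with |y′|_w = |z′|_w lies in the connected component of z′; (b) some factorization y ∈ Z_{P_n}(β) with |y|_w = |z|_w has y₁ > 0; and (c) some factorization y′ ∈ Z_{P_n}(β) with |y′|_w = |z′|_w has y′_k > 0. -/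
open Finset

/-- Every finitely supported multiplicity vector is the end of a chain growing by one unit at a
time from zero. -/
theorem exists_monotone_chain {ι : Type*} [Fintype ι] (N : ℕ) :
    ∀ v : ι → ℕ, ∑ i, v i = N →
      ∃ c : ℕ → ι → ℕ, Monotone c ∧ (∀ j, c j ≤ v) ∧ ∀ j ≤ N, ∑ i, c j i = j := by
  classical
  induction N with
  | zero =>
    intro v _
    exact ⟨fun _ => 0, fun _ _ _ => le_rfl, fun _ i => Nat.zero_le _, fun j hj => by simp; omega⟩
  | succ N ih =>
    intro v hv
    obtain ⟨t, -, ht⟩ : ∃ t ∈ Finset.univ, v t ≠ 0 :=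
      Finset.exists_ne_zero_of_sum_ne_zero (by omega)
    have hle : Pi.single t 1 ≤ v := by
      intro i
      by_cases h : i = t
      · subst h; simp; omega
      · simp [h]
    have hsum : ∑ i, (v - (Pi.single t 1 : ι → ℕ)) i = N := by
      have h : ∑ i, ((v - (Pi.single t 1 : ι → ℕ)) i + (Pi.single t 1 : ι → ℕ) i) = N + 1 := by
        rw [← hv]
        exact Finset.sum_congr rfl fun i _ => Nat.sub_add_cancel (hle i)
      rw [Finset.sum_add_distrib, Finset.sum_pi_single'] at h
      simpa using h
    obtain ⟨c, hmono, hcv, hcs⟩ := ih _ hsum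
    have hcv' : ∀ j, c j ≤ v := fun j => (hcv j).trans fun i => Nat.sub_le _ _
    refine ⟨fun j => if j ≤ N then c j else v, ?_, ?_, ?_⟩
    · intro a b hab
      by_cases hb : b ≤ N
      · simpa [hb, hab.trans hb] using hmono hab
      · by_cases ha : a ≤ N
        · simpa [hb, ha] using hcv' a
        · simp [hb, ha]
    · intro j
      by_cases hj : j ≤ N
      · simpa [hj] using hcv' j
      · simp [hj]
    · intro j hj
      by_cases hj' : j ≤ N
      · simpa [hj'] using hcs j hj'
      · simp only [hj', if_false]
        omega

/-- A multiset of more than `A * P` vectors `(w i, r i)`, where `P = A * D - C * B > 0`, has a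
nonempty proper part whose sum lies in the lattice spanned by `(A, B)` and `(C, D)`. -/
theorem exists_lattice_part {ι : Type*} [Fintype ι] (w r : ι → ℕ) {A B C D P : ℤ}
    (hA : 0 < A) (hP : 0 < P) (hPdef : P = A * D - C * B) (v : ι → ℕ)
    (hv : A * P < ∑ i, (v i : ℤ)) :
    ∃ u ≤ v, 0 < ∑ i, u i ∧ ∑ i, u i < ∑ i, v i ∧
      ∃ a b : ℤ, ∑ i, (u i : ℤ) * w i = a * A + b * C ∧
        ∑ i, (u i : ℤ) * r i = a * B + b * D := by
  obtain ⟨c, hmono, hcv, hcs⟩ := exists_monotone_chain (∑ i, v i) v rfl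
  set X : ℕ → ℤ := fun j => ∑ i, (c j i : ℤ) * w i
  set Y : ℕ → ℤ := fun j => ∑ i, (c j i : ℤ) * r i
  set N : ℕ := (A * P).toNat with hN
  have hAP : 0 < A * P := mul_pos hA hP
  have hNv : N < ∑ i, v i := by
    have : ((∑ i, v i : ℕ) : ℤ) = ∑ i, (v i : ℤ) := by push_cast; rfl
    omega
  have hcard : (Finset.Ico (0 : ℤ) A ×ˢ Finset.Ico (0 : ℤ) P).card
      < (Finset.range (N + 1)).card := by
    rw [Finset.card_product, Finset.card_range, Int.card_Ico, Int.card_Ico, sub_zero, sub_zero, hN,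
      Int.toNat_mul hA.le hP.le]
    exact Nat.lt_succ_self _
  obtain ⟨j, hj, l, hl, hjl, heq⟩ : ∃ j ∈ Finset.range (N + 1), ∃ l ∈ Finset.range (N + 1),
      j < l ∧ (X j % A, (Y j - X j / A * B) % P) = (X l % A, (Y l - X l / A * B) % P) := by
    obtain ⟨j, hj, l, hl, hne, h⟩ := Finset.exists_ne_map_eq_of_card_lt_of_maps_to hcard
      (f := fun j => (X j % A, (Y j - X j / A * B) % P)) (by
        intro j _
        simp only [Finset.coe_product, Set.mem_prod, Finset.coe_Ico, Set.mem_Ico]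
        exact ⟨⟨Int.emod_nonneg _ hA.ne', Int.emod_lt_of_pos _ hA⟩,
          ⟨Int.emod_nonneg _ hP.ne', Int.emod_lt_of_pos _ hP⟩⟩)
    rcases lt_or_gt_of_ne hne with h' | h'
    · exact ⟨j, hj, l, hl, h', h⟩
    · exact ⟨l, hl, j, hj, h', h.symm⟩
  rw [Finset.mem_range] at hj hl
  rw [Prod.mk.injEq] at heq
  obtain ⟨hx, hy⟩ := heq
  have hle : c j ≤ c l := hmono hjl.le
  have hsum : ∑ i, (c l - c j) i = l - j := by
    have h : ∑ i, ((c l - c j) i + c j i) = ∑ i, c l i :=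
      Finset.sum_congr rfl fun i _ => Nat.sub_add_cancel (hle i)
    rw [Finset.sum_add_distrib, hcs j (by omega), hcs l (by omega)] at h
    omega
  have hdiff : ∀ f : ι → ℕ, ∑ i, (((c l - c j) i : ℕ) : ℤ) * f i
      = ∑ i, (c l i : ℤ) * f i - ∑ i, (c j i : ℤ) * f i := by
    intro f
    rw [← Finset.sum_sub_distrib]
    refine Finset.sum_congr rfl fun i _ => ?_
    rw [Pi.sub_apply, Nat.cast_sub (hle i)]
    ring
  obtain ⟨t, ht⟩ := Int.ModEq.dvd hy
  refine ⟨c l - c j, fun i => (Nat.sub_le _ _).trans (hcv l i), by omega, by omega,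
    X l / A - X j / A - t * C, t * A, ?_, ?_⟩
  · rw [hdiff]
    have h1 := Int.emod_add_mul_ediv (X j) A
    have h2 := Int.emod_add_mul_ediv (X l) A
    change X l - X j = _
    linear_combination h1 - h2 - hx
  · rw [hdiff]
    change Y l - Y j = _
    linear_combination ht + t * hPdef

/-- Trading a part of `z` for copies of the extremal generators `a` and `b`, keeping both
`∑ z i * w i` and `∑ z i * r i` as well as part of the support of `z`. -/
theorem exists_extremal_trade {ι : Type*} [Fintype ι] [DecidableEq ι] (w r : ι → ℕ) (a b : ι)
    (ha : 0 < w a) {P : ℤ} (hP : 0 < P) (hPdef : P = (w a : ℤ) * r b - w b * r a)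
    (hp : ∀ i, 0 ≤ (w a : ℤ) * r i - w i * r a) (hq : ∀ i, 0 ≤ (w i : ℤ) * r b - w b * r i)
    (z : ι → ℕ) (s : Finset ι) (hs : w a * P < ∑ i ∈ s, (z i : ℤ)) :
    ∃ y : ι → ℕ, ∑ i, y i * w i = ∑ i, z i * w i ∧ ∑ i, y i * r i = ∑ i, z i * r i ∧
      (∃ t, z t ≠ 0 ∧ y t ≠ 0) ∧
      ((∀ i ∈ s, 0 < (w i : ℤ) * r b - w b * r i) → 0 < y a) ∧
      ((∀ i ∈ s, 0 < (w a : ℤ) * r i - w i * r a) → 0 < y b) := by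
  set v : ι → ℕ := fun i => if i ∈ s then z i else 0 with hvdef
  have hvz : v ≤ z := by
    intro i
    by_cases h : i ∈ s <;> simp [hvdef, h]
  have hvs : ∑ i, (v i : ℤ) = ∑ i ∈ s, (z i : ℤ) := by
    simp [hvdef, Finset.sum_ite_mem]
  obtain ⟨u, huv, hu0, hulv, m, l, hmw, hmr⟩ :=
    exists_lattice_part w r (A := w a) (B := r a) (C := w b) (D := r b)
      (by exact_mod_cast ha) hP hPdef v (by rwa [hvs])
  have huz : u ≤ z := huv.trans hvz
  have hm : P * m = ∑ i, (u i : ℤ) * ((w i : ℤ) * r b - w b * r i) := by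
    have : ∑ i, (u i : ℤ) * ((w i : ℤ) * r b - w b * r i)
        = (∑ i, (u i : ℤ) * w i) * r b - w b * ∑ i, (u i : ℤ) * r i := by
      rw [Finset.sum_mul, Finset.mul_sum, ← Finset.sum_sub_distrib]
      exact Finset.sum_congr rfl fun i _ => by ring
    rw [this, hmw, hmr, hPdef]
    ring
  have hl : P * l = ∑ i, (u i : ℤ) * ((w a : ℤ) * r i - w i * r a) := by
    have : ∑ i, (u i : ℤ) * ((w a : ℤ) * r i - w i * r a)
        = w a * (∑ i, (u i : ℤ) * r i) - (∑ i, (u i : ℤ) * w i) * r a := by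
      rw [Finset.sum_mul, Finset.mul_sum, ← Finset.sum_sub_distrib]
      exact Finset.sum_congr rfl fun i _ => by ring
    rw [this, hmw, hmr, hPdef]
    ring
  have hm0 : 0 ≤ m := nonneg_of_mul_nonneg_right
    (hm ▸ Finset.sum_nonneg fun i _ => mul_nonneg (by positivity) (hq i)) hP
  have hl0 : 0 ≤ l := nonneg_of_mul_nonneg_right
    (hl ▸ Finset.sum_nonneg fun i _ => mul_nonneg (by positivity) (hp i)) hP
  obtain ⟨i₀, -, hi₀⟩ : ∃ i ∈ Finset.univ, u i ≠ 0 :=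
    Finset.exists_ne_zero_of_sum_ne_zero hu0.ne'
  have hi₀s : i₀ ∈ s := by
    by_contra h
    have := huv i₀
    simp [hvdef, h] at this
    exact hi₀ this
  have hpos : ∀ f : ι → ℤ, (∀ i, 0 ≤ f i) → 0 < f i₀ → 0 < ∑ i, (u i : ℤ) * f i := by
    intro f hf hf0
    exact Finset.sum_pos' (fun i _ => mul_nonneg (by positivity) (hf i))
      ⟨i₀, Finset.mem_univ _, mul_pos (by exact_mod_cast Nat.pos_of_ne_zero hi₀) hf0⟩
  lift m to ℕ using hm0
  lift l to ℕ using hl0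
  set y : ι → ℕ := fun i => (z i - u i) + ((if i = a then m else 0) + (if i = b then l else 0))
    with hy
  have hysum : ∀ f : ι → ℕ, ∑ i, (u i : ℤ) * f i = m * f a + l * f b →
      ∑ i, y i * f i = ∑ i, z i * f i := by
    intro f hf
    have hf' : ∑ i, u i * f i = m * f a + l * f b := by exact_mod_cast hf
    have h1 : ∑ i, y i * f i = ∑ i, (z i - u i) * f i + (m * f a + l * f b) := by
      simp [hy, add_mul, Finset.sum_add_distrib, ite_mul]
    rw [h1, ← hf', ← Finset.sum_add_distrib]
    refine Finset.sum_congr rfl fun i _ => ?_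
    rw [← add_mul, Nat.sub_add_cancel (huz i)]
  refine ⟨y, hysum w hmw, hysum r hmr, ?_, ?_, ?_⟩
  · obtain ⟨t, -, ht⟩ := Finset.exists_lt_of_sum_lt hulv
    have hlt : u t < z t := ht.trans_le (hvz t)
    exact ⟨t, by omega, by simp only [hy]; omega⟩
  · intro h
    have : 0 < (m : ℤ) := pos_of_mul_pos_right (hm ▸ hpos _ hq (h i₀ hi₀s)) hP.le
    simp only [hy, if_true]
    omega
  · intro h
    have : 0 < (l : ℤ) := pos_of_mul_pos_right (hl ▸ hpos _ hp (h i₀ hi₀s)) hP.le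
    simp only [hy, if_true]
    omega

/-- If `∑ z i * f i > K * M` with `0 ≤ f ≤ M`, then `z` has more than `K` units on the support
of `f`. -/
theorem lt_sum_filter_pos {ι : Type*} [Fintype ι] (f : ι → ℤ) {M K : ℤ} (hf : ∀ i, 0 ≤ f i)
    (hM : 0 ≤ M) (hfM : ∀ i, f i ≤ M) (z : ι → ℕ) (h : K * M < ∑ i, (z i : ℤ) * f i) :
    K < ∑ i ∈ Finset.univ.filter (fun i => 0 < f i), (z i : ℤ) := by
  refine lt_of_mul_lt_mul_right (h.trans_le ?_) hM
  rw [Finset.sum_mul, Finset.sum_filter]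
  refine Finset.sum_le_sum fun i _ => ?_
  split_ifs with h0
  · exact mul_le_mul_of_nonneg_left (hfM i) (by positivity)
  · rw [le_antisymm (not_lt.mp h0) (hf i), mul_zero]

/-- Theorem (Betti elements of `P_n = ⟨w₁n+r₁,…,w_kn+r_k⟩` for large `n`): suppose
`n > w₁²·W·R²`, and `z, z'` are factorizations of `β ∈ P_n` lying in different
connected components of the factorization graph `∇_β` with `|z|_w > |z'|_w`.  Then
(a) every factorization of weighted length `|z|_w` (resp. `|z'|_w`) is connected to
`z` (resp. `z'`); (b) some factorization `y` with `|y|_w = |z|_w` has `y₁ > 0`;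
(c) some factorization `y'` with `|y'|_w = |z'|_w` has `y'_k > 0`.
Generators are indexed by `Fin (k+1)` with `k ≥ 1`; `Rel` is connectivity in `∇_β`. -/
theorem stmt_9 (k : ℕ) (hk : 1 ≤ k)
    (w r : Fin (k+1) → ℕ) (hw : ∀ i, 1 ≤ w i) (hr0 : r 0 < w 0)
    (hsort : ∀ i j : Fin (k+1), i ≤ j → (r i : ℚ) / (w i : ℚ) ≤ (r j : ℚ) / (w j : ℚ))
    (n : ℕ) (hn : (w 0) ^ 2 * (Finset.univ.sup w) * (Finset.univ.sup r) ^ 2 < n)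
    (β : ℕ) (z z' : Fin (k+1) → ℕ)
    (hz : β = ∑ i, z i * (w i * n + r i))
    (hz' : β = ∑ i, z' i * (w i * n + r i))
    (Rel : (Fin (k+1) → ℕ) → (Fin (k+1) → ℕ) → Prop)
    (hRel : Rel = Relation.ReflTransGen (fun x y : Fin (k+1) → ℕ =>
      (β = ∑ i, x i * (w i * n + r i)) ∧ (β = ∑ i, y i * (w i * n + r i)) ∧
        ∃ t, x t ≠ 0 ∧ y t ≠ 0))
    (hdiff : ¬ Rel z z')
    (hlen : ∑ i, z' i * w i < ∑ i, z i * w i) :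
    ((∀ y : Fin (k+1) → ℕ, β = ∑ i, y i * (w i * n + r i) →
        ∑ i, y i * w i = ∑ i, z i * w i → Rel z y) ∧
     (∀ y' : Fin (k+1) → ℕ, β = ∑ i, y' i * (w i * n + r i) →
        ∑ i, y' i * w i = ∑ i, z' i * w i → Rel z' y')) ∧
    (∃ y : Fin (k+1) → ℕ, β = ∑ i, y i * (w i * n + r i) ∧
        ∑ i, y i * w i = ∑ i, z i * w i ∧ 0 < y 0) ∧
    (∃ y' : Fin (k+1) → ℕ, β = ∑ i, y' i * (w i * n + r i) ∧
        ∑ i, y' i * w i = ∑ i, z' i * w i ∧ 0 < y' (Fin.last k)) := by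
  have hcross : ∀ i j, i ≤ j → 0 ≤ (w i : ℤ) * r j - w j * r i := by
    intro i j hij
    have h := hsort i j hij
    rw [div_le_div_iff₀ (by exact_mod_cast hw i) (by exact_mod_cast hw j)] at h
    have h' : r i * w j ≤ r j * w i := by exact_mod_cast h
    zify at h'
    linarith
  have hp : ∀ i, 0 ≤ (w 0 : ℤ) * r i - w i * r 0 := fun i => hcross 0 i (Fin.zero_le i)
  have hq : ∀ i, 0 ≤ (w i : ℤ) * r (Fin.last k) - w (Fin.last k) * r i :=
    fun i => hcross i _ (Fin.le_last i)
  set W := Finset.univ.sup w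
  set R := Finset.univ.sup r
  have hwW : ∀ i, (w i : ℤ) ≤ W := fun i => by exact_mod_cast Finset.le_sup (Finset.mem_univ i)
  have hrR : ∀ i, (r i : ℤ) ≤ R := fun i => by exact_mod_cast Finset.le_sup (Finset.mem_univ i)
  have hw' : ∀ i, (1 : ℤ) ≤ w i := fun i => by exact_mod_cast hw i
  have hW : (1 : ℤ) ≤ W := (hw' 0).trans (hwW 0)
  have hn' : (w 0 : ℤ) ^ 2 * W * R ^ 2 < n := by exact_mod_cast hn
  obtain ⟨P, hPdef⟩ : ∃ P : ℤ, P = (w 0 : ℤ) * r (Fin.last k) - w (Fin.last k) * r 0 := ⟨_, rfl⟩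
  have hsplit : ∀ x : Fin (k+1) → ℕ,
      ∑ i, x i * (w i * n + r i) = (∑ i, x i * w i) * n + ∑ i, x i * r i := by
    intro x
    rw [Finset.sum_mul, ← Finset.sum_add_distrib]
    exact Finset.sum_congr rfl fun i _ => by ring
  have hqsum : ∀ x : Fin (k+1) → ℕ, β = ∑ i, x i * (w i * n + r i) →
      ∑ i, (x i : ℤ) * ((w i : ℤ) * r (Fin.last k) - w (Fin.last k) * r i)
        = (∑ i, x i * w i : ℕ) * ((w (Fin.last k) : ℤ) * n + r (Fin.last k))
          - w (Fin.last k) * β := by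
    intro x hx
    rw [hsplit] at hx
    rw [hx]
    push_cast
    have : ∑ i, (x i : ℤ) * ((w i : ℤ) * r (Fin.last k) - w (Fin.last k) * r i)
        = (∑ i, (x i : ℤ) * w i) * r (Fin.last k) - w (Fin.last k) * ∑ i, (x i : ℤ) * r i := by
      rw [Finset.sum_mul, Finset.mul_sum, ← Finset.sum_sub_distrib]
      exact Finset.sum_congr rfl fun i _ => by ring
    rw [this]
    ring
  have hpsum : ∀ x : Fin (k+1) → ℕ, β = ∑ i, x i * (w i * n + r i) →
      ∑ i, (x i : ℤ) * ((w 0 : ℤ) * r i - w i * r 0)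
        = w 0 * β - (∑ i, x i * w i : ℕ) * ((w 0 : ℤ) * n + r 0) := by
    intro x hx
    rw [hsplit] at hx
    rw [hx]
    push_cast
    have : ∑ i, (x i : ℤ) * ((w 0 : ℤ) * r i - w i * r 0)
        = w 0 * (∑ i, (x i : ℤ) * r i) - (∑ i, (x i : ℤ) * w i) * r 0 := by
      rw [Finset.sum_mul, Finset.mul_sum, ← Finset.sum_sub_distrib]
      exact Finset.sum_congr rfl fun i _ => by ring
    rw [this]
    ring
  have hlen' : ((∑ i, z' i * w i : ℕ) : ℤ) + 1 ≤ (∑ i, z i * w i : ℕ) := by exact_mod_cast hlen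
  have hqlarge : ∀ y : Fin (k+1) → ℕ, β = ∑ i, y i * (w i * n + r i) →
      ∑ i, y i * w i = ∑ i, z i * w i →
      (n : ℤ) ≤ ∑ i, (y i : ℤ) * ((w i : ℤ) * r (Fin.last k) - w (Fin.last k) * r i) := by
    intro y hy hyl
    have h0 := Finset.sum_nonneg (s := Finset.univ) fun i _ =>
      mul_nonneg (Int.natCast_nonneg (z' i)) (hq i)
    rw [hqsum z' hz'] at h0
    rw [hqsum y hy, hyl]
    nlinarith [Int.natCast_nonneg (r (Fin.last k)),
      mul_nonneg (sub_nonneg.2 (hw' (Fin.last k))) (Int.natCast_nonneg n),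
      mul_nonneg (sub_nonneg.2 hlen') (by positivity :
        (0 : ℤ) ≤ (w (Fin.last k) : ℤ) * n + r (Fin.last k))]
  have hplarge : ∀ y : Fin (k+1) → ℕ, β = ∑ i, y i * (w i * n + r i) →
      ∑ i, y i * w i = ∑ i, z' i * w i →
      (w 0 : ℤ) * n ≤ ∑ i, (y i : ℤ) * ((w 0 : ℤ) * r i - w i * r 0) := by
    intro y hy hyl
    have h0 := Finset.sum_nonneg (s := Finset.univ) fun i _ =>
      mul_nonneg (Int.natCast_nonneg (z i)) (hp i)
    rw [hpsum z hz] at h0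
    rw [hpsum y hy, hyl]
    nlinarith [Int.natCast_nonneg (r 0),
      mul_nonneg (sub_nonneg.2 hlen') (by positivity : (0 : ℤ) ≤ (w 0 : ℤ) * n + r 0)]
  have hP : 0 < P := by
    by_contra hP
    have hqz : ∀ i, (w i : ℤ) * r (Fin.last k) - w (Fin.last k) * r i = 0 := by
      intro i
      nlinarith [hq i, hw' 0, hw' i, mul_nonneg (hp i) (Int.natCast_nonneg (w (Fin.last k))),
        mul_nonneg (sub_nonneg.2 (hw' 0)) (hq i),
        mul_nonneg (neg_nonneg.2 (not_lt.mp hP)) (Int.natCast_nonneg (w i))]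
    have := hqlarge z hz rfl
    simp only [hqz, mul_zero, Finset.sum_const_zero] at this
    have : (0 : ℤ) ≤ (w 0 : ℤ) ^ 2 * W * R ^ 2 := by positivity
    omega
  have hPR : P ≤ w 0 * R := by
    have := mul_le_mul_of_nonneg_left (hrR (Fin.last k)) (Int.natCast_nonneg (w 0))
    have : (0 : ℤ) ≤ w (Fin.last k) * r 0 := by positivity
    linarith
  have hqtrade : ∀ x : Fin (k+1) → ℕ, β = ∑ i, x i * (w i * n + r i) →
      ∑ i, x i * w i = ∑ i, z i * w i →
      ∃ y : Fin (k+1) → ℕ, β = ∑ i, y i * (w i * n + r i) ∧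
        ∑ i, y i * w i = ∑ i, z i * w i ∧ (∃ t, x t ≠ 0 ∧ y t ≠ 0) ∧ 0 < y 0 := by
    intro x hx hxl
    obtain ⟨y, hyw, hyr, ht, h0, -⟩ := exists_extremal_trade w r 0 (Fin.last k) (hw 0) hP hPdef
      hp hq x _ (lt_sum_filter_pos _ (M := W * R) hq (by positivity) (fun i => by
        have h1 := mul_le_mul (hwW i) (hrR (Fin.last k)) (by positivity) (by positivity)
        have h2 : (0 : ℤ) ≤ w (Fin.last k) * r i := by positivity
        linarith) x (by
        refine lt_of_lt_of_le (lt_of_le_of_lt ?_ hn') (hqlarge x hx hxl)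
        calc (w 0 : ℤ) * P * (W * R) ≤ w 0 * (w 0 * R) * (W * R) := by gcongr
          _ = _ := by ring))
    exact ⟨y, by rw [hx, hsplit, hsplit, hyw, hyr], hyw.trans hxl, ht,
      h0 fun i hi => (Finset.mem_filter.1 hi).2⟩
  have hptrade : ∀ x : Fin (k+1) → ℕ, β = ∑ i, x i * (w i * n + r i) →
      ∑ i, x i * w i = ∑ i, z' i * w i →
      ∃ y : Fin (k+1) → ℕ, β = ∑ i, y i * (w i * n + r i) ∧
        ∑ i, y i * w i = ∑ i, z' i * w i ∧ (∃ t, x t ≠ 0 ∧ y t ≠ 0) ∧ 0 < y (Fin.last k) := by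
    intro x hx hxl
    obtain ⟨y, hyw, hyr, ht, -, h0⟩ := exists_extremal_trade w r 0 (Fin.last k) (hw 0) hP hPdef
      hp hq x _ (lt_sum_filter_pos _ (M := w 0 * R) hp (by positivity) (fun i => by
        have h1 := mul_le_mul_of_nonneg_left (hrR i) (Int.natCast_nonneg (w 0))
        have h2 : (0 : ℤ) ≤ w i * r 0 := by positivity
        linarith) x (by
        refine lt_of_lt_of_le ?_ (hplarge x hx hxl)
        calc (w 0 : ℤ) * P * (w 0 * R) ≤ w 0 * (w 0 * R) * (w 0 * R) := by gcongr
          _ = w 0 * (w 0 ^ 2 * 1 * R ^ 2) := by ring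
          _ ≤ w 0 * (w 0 ^ 2 * W * R ^ 2) := by gcongr
          _ < w 0 * n := by
            have := hw' 0
            gcongr))
    exact ⟨y, by rw [hx, hsplit, hsplit, hyw, hyr], hyw.trans hxl, ht,
      h0 fun i hi => (Finset.mem_filter.1 hi).2⟩
  have hjoin : ∀ (j : Fin (k+1)) (x₁ y₁ x₂ y₂ : Fin (k+1) → ℕ),
      β = ∑ i, x₁ i * (w i * n + r i) → β = ∑ i, y₁ i * (w i * n + r i) →
      β = ∑ i, x₂ i * (w i * n + r i) → β = ∑ i, y₂ i * (w i * n + r i) →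
      (∃ t, x₁ t ≠ 0 ∧ y₁ t ≠ 0) → (∃ t, x₂ t ≠ 0 ∧ y₂ t ≠ 0) → 0 < y₁ j → 0 < y₂ j →
      Rel x₁ x₂ := by
    intro j x₁ y₁ x₂ y₂ hx₁ hy₁ hx₂ hy₂ h₁ ⟨t, ht, ht'⟩ hj₁ hj₂
    rw [hRel]
    exact ((Relation.ReflTransGen.single ⟨hx₁, hy₁, h₁⟩).tail
      ⟨hy₁, hy₂, j, hj₁.ne', hj₂.ne'⟩).tail ⟨hy₂, hx₂, t, ht', ht⟩
  obtain ⟨y, hy, hyl, hyt, hy0⟩ := hqtrade z hz rfl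
  obtain ⟨y', hy', hyl', hyt', hy0'⟩ := hptrade z' hz' rfl
  refine ⟨⟨fun x hx hxl => ?_, fun x hx hxl => ?_⟩, ⟨y, hy, hyl, hy0⟩, ⟨y', hy', hyl', hy0'⟩⟩
  · obtain ⟨u, hu, -, hut, hu0⟩ := hqtrade x hx hxl
    exact hjoin 0 z y x u hz hy hx hu hyt hut hy0 hu0
  · obtain ⟨u, hu, -, hut, hu0⟩ := hptrade x hx hxl
    exact hjoin (Fin.last k) z' y' x u hz' hy' hx hu hyt' hut hy0' hu0
end

section
/- Let π_n : ℤ_{≥0}^k → ℤ_{≥0} denote π_n(z) = z₁(w₁n+r₁)+⋯+z_k(w_kn+r_k), and let e₁, e_k denote the first and last standard basis vectors of ℤ^k. For every integer n ≥ 1 and all z, z′ ∈ ℤ_{≥0}^k with π_n(z) = π_n(z′) and |z|_w ≥ |z′|_w, setting ℓ = |z|_w − |z′|_w, we have π_{n+p}(z + ℓw_k·e₁) = π_{n+p}(z′ + ℓw₁·e_k). -/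
open Finset

/-- Shifting the parameter by `p` adds `p` times the weighted length to the value, and adding
`c` copies of the `j`-th generator adds `c` times that generator. -/
theorem sum_shift_add_single {ι : Type*} [Fintype ι] [DecidableEq ι] (w r z : ι → ℕ)
    (n p c : ℕ) (j : ι) :
    ∑ i, (z + Pi.single j c : ι → ℕ) i * (w i * (n + p) + r i)
      = ∑ i, z i * (w i * n + r i) + p * ∑ i, z i * w i + c * (w j * (n + p) + r j) := by
  have h : ∑ i, (Pi.single j c : ι → ℕ) i * (w i * (n + p) + r i)
      = c * (w j * (n + p) + r j) := by
    simp [Pi.single_apply]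
  rw [← h, mul_sum, ← sum_add_distrib, ← sum_add_distrib]
  refine sum_congr rfl fun i _ => ?_
  rw [Pi.add_apply]
  ring

/-- Proposition (the map `Φ_n` is well defined): for `n ≥ 1` and `z, z'` with
`π_n(z) = π_n(z')` and `|z|_w ≥ |z'|_w`, setting `ℓ = |z|_w − |z'|_w`, we have
`π_{n+p}(z + ℓw_k·e₁) = π_{n+p}(z' + ℓw₁·e_k)`, where `p = w₁r_k − w_kr₁`.
Generators are indexed by `Fin (k+1)` with `k ≥ 1`; `e₁ = Pi.single 0 1` and
`e_k = Pi.single (Fin.last k) 1`. -/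
theorem stmt_11 (k : ℕ) (hk : 1 ≤ k)
    (w r : Fin (k+1) → ℕ) (hw : ∀ i, 1 ≤ w i) (hr0 : r 0 < w 0)
    (hsort : ∀ i j : Fin (k+1), i ≤ j → (r i : ℚ) / (w i : ℚ) ≤ (r j : ℚ) / (w j : ℚ))
    (p : ℕ) (hp : p = w 0 * r (Fin.last k) - w (Fin.last k) * r 0)
    (π : ℕ → (Fin (k+1) → ℕ) → ℕ)
    (hπ : ∀ N : ℕ, ∀ z : Fin (k+1) → ℕ, π N z = ∑ i, z i * (w i * N + r i))
    (n : ℕ) (hn : 1 ≤ n)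
    (z z' : Fin (k+1) → ℕ)
    (heq : π n z = π n z')
    (hlen : ∑ i, z' i * w i ≤ ∑ i, z i * w i) :
    π (n + p) (z + Pi.single 0 ((∑ i, z i * w i - ∑ i, z' i * w i) * w (Fin.last k)))
      = π (n + p)
        (z' + Pi.single (Fin.last k) ((∑ i, z i * w i - ∑ i, z' i * w i) * w 0)) := by
  have hslope : w (Fin.last k) * r 0 ≤ w 0 * r (Fin.last k) := by
    have h0 : (0 : ℚ) < w 0 := by exact_mod_cast hw 0
    have hl : (0 : ℚ) < w (Fin.last k) := by exact_mod_cast hw (Fin.last k)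
    have h := (div_le_div_iff₀ h0 hl).1 (hsort 0 (Fin.last k) (Fin.zero_le _))
    have h' : r 0 * w (Fin.last k) ≤ r (Fin.last k) * w 0 := by exact_mod_cast h
    linarith
  have hp' : p + w (Fin.last k) * r 0 = w 0 * r (Fin.last k) := by omega
  obtain ⟨l, hl⟩ := Nat.exists_eq_add_of_le hlen
  rw [hπ, hπ] at heq
  rw [hπ, hπ, sum_shift_add_single, sum_shift_add_single, heq, hl, Nat.add_sub_cancel_left]
  linear_combination l * hp'
end

section
/- For every integer n > w₁²·W·R², if ρ is a minimal presentation of P_n, then its image Φ_n(ρ) = {Φ_n(z,z′) : (z,z′) ∈ ρ} is a minimal presentation of P_{n+p}. -/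
open Finset

/-- Among any `p + 1` points of `ℤ²` two are congruent modulo the lattice spanned by two vectors
of determinant `p`. -/
theorem exists_lt_sub_mem_lattice {a b c d p : ℕ} (ha : 0 < a) (hp : 0 < p)
    (hdet : p + b * c = a * d) (A B : ℕ → ℤ) :
    ∃ i j, i < j ∧ j ≤ p ∧ ∃ x y : ℤ, A j - A i = a * x + b * y ∧ B j - B i = c * x + d * y := by
  obtain ⟨α, hα⟩ := Nat.gcd_dvd_left a b
  obtain ⟨β, hβ⟩ := Nat.gcd_dvd_right a b
  have hbez := Nat.gcd_eq_gcd_ab a b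
  have hg : 0 < Nat.gcd a b := Nat.gcd_pos_of_pos_left b ha
  obtain ⟨q, hq⟩ : Nat.gcd a b ∣ p := by
    rw [← Nat.dvd_add_left (Dvd.dvd.mul_right (Nat.gcd_dvd_right a b) c), hdet]
    exact Dvd.dvd.mul_right (Nat.gcd_dvd_left a b) d
  generalize Nat.gcd a b = g at *
  have hq0 : 0 < q := Nat.pos_of_mul_pos_left (hq ▸ hp)
  set u := Nat.gcdA a b
  set v := Nat.gcdB a b
  set h : ℤ := c * u + d * v with hh
  let F : ℕ → ℤ × ℤ := fun i => (A i % g, (B i - h * (A i / g)) % q)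
  have hF : ∀ i ∈ range (p + 1), F i ∈ Ico (0 : ℤ) g ×ˢ Ico (0 : ℤ) q := by
    intro i _
    have h1 : (0 : ℤ) < g := by exact_mod_cast hg
    have h2 : (0 : ℤ) < q := by exact_mod_cast hq0
    simp only [F, mem_product, mem_Ico]
    exact ⟨⟨Int.emod_nonneg _ h1.ne', Int.emod_lt_of_pos _ h1⟩,
      Int.emod_nonneg _ h2.ne', Int.emod_lt_of_pos _ h2⟩
  have hcard : #(Ico (0 : ℤ) g ×ˢ Ico (0 : ℤ) q) < #(range (p + 1)) := by
    simp [hq]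
  obtain ⟨i, hi, j, hj, hne, hij⟩ := exists_ne_map_eq_of_card_lt_of_maps_to hcard hF
  wlog hlt : i < j generalizing i j
  · exact this j hj i hi hne.symm hij.symm (by lia)
  refine ⟨i, j, hlt, by simpa [Nat.lt_succ_iff] using hj, ?_⟩
  simp only [F, Prod.mk.injEq] at hij
  obtain ⟨h1, h2⟩ := hij
  have hAi := Int.emod_add_mul_ediv (A i) g
  have hAj := Int.emod_add_mul_ediv (A j) g
  obtain ⟨σ, hσ⟩ := (Int.ModEq.dvd h2 :
    (q : ℤ) ∣ (B j - h * (A j / g)) - (B i - h * (A i / g)))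
  set T := A j / g - A i / g with hT
  have hA : A j - A i = g * T := by rw [hT, mul_sub]; linarith
  have hB : B j - B i = h * T + q * σ := by rw [hT, mul_sub]; linarith
  have hqd : (q : ℤ) = α * d - β * c := by
    have hg' : (g : ℤ) ≠ 0 := by exact_mod_cast hg.ne'
    apply mul_left_cancel₀ hg'
    have e1 : (a : ℤ) = g * α := by exact_mod_cast hα
    have e2 : (b : ℤ) = g * β := by exact_mod_cast hβ
    have e3 : (p : ℤ) = g * q := by exact_mod_cast hq
    have e4 : (p : ℤ) + b * c = a * d := by exact_mod_cast hdet
    rw [← e3, eq_sub_of_add_eq e4, e1, e2]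
    ring
  refine ⟨T * u - σ * β, T * v + σ * α, ?_, ?_⟩
  · have e1 : (a : ℤ) = g * α := by exact_mod_cast hα
    have e2 : (b : ℤ) = g * β := by exact_mod_cast hβ
    rw [hA]
    have : (a : ℤ) * β = b * α := by rw [e1, e2]; ring
    linear_combination T * hbez + σ * this
  · rw [hB, hh, hqd]
    ring

/-- A vector of naturals with large sum dominates an increasing chain of vectors with sums
`0, 1, …, m`. -/
theorem exists_chain_le {ι : Type*} [Fintype ι] [DecidableEq ι] (f : ι → ℕ) (m : ℕ)
    (hm : m ≤ ∑ i, f i) :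
    ∃ c : ℕ → ι → ℕ, Monotone c ∧ (∀ j, c j ≤ f) ∧ ∀ j ≤ m, ∑ i, c j i = j := by
  induction m with
  | zero => exact ⟨fun _ => 0, monotone_const, fun _ _ => Nat.zero_le _, by simp⟩
  | succ m ih =>
    obtain ⟨c, hmono, hle, hsum⟩ := ih (by lia)
    obtain ⟨i, -, hi⟩ : ∃ i ∈ univ, c m i < f i := by
      apply exists_lt_of_sum_lt
      rw [hsum m le_rfl]
      exact hm
    refine ⟨fun j => if j ≤ m then c j else c m + Pi.single i 1, ?_, ?_, ?_⟩
    · intro j j' hj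
      dsimp only
      split_ifs with h1 h2 h2
      · exact hmono hj
      · exact (hmono h1).trans le_self_add
      · lia
      · exact le_rfl
    · intro j
      dsimp only
      split_ifs with h1
      · exact hle j
      · intro x
        by_cases hx : x = i
        · subst hx
          simpa using hi
        · simpa [hx] using hle m x
    · intro j hj
      dsimp only
      split_ifs with h1
      · exact hsum j h1
      · simp [sum_add_distrib, hsum m le_rfl]
        lia

theorem exists_eq_add_single {ι : Type*} [DecidableEq ι] {y : ι → ℕ} {i : ι} {m : ℕ} (h : m ≤ y i) :
    ∃ x : ι → ℕ, y = x + Pi.single i m := by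
  have hle : Pi.single i m ≤ y := by
    intro j
    by_cases hj : j = i
    · subst hj
      simpa using h
    · simp [hj]
  obtain ⟨x, hx⟩ := exists_add_of_le hle
  exact ⟨x, hx.trans (add_comm _ _)⟩

section GeneratedCongruence

variable {ι : Type*} {z z' : ι → ℕ} {ρ : Set ((ι → ℕ) × (ι → ℕ))}

/-- The congruence relation generated by a set of pairs. -/
abbrev genCon (ρ : Set ((ι → ℕ) × (ι → ℕ))) : AddCon (ι → ℕ) := addConGen fun a b => (a, b) ∈ ρ

/-- An equivalence relation closed under translation is a congruence relation. -/
def AddCon.ofTranslation {A : Type*} [AddCommMonoid A] (S : A → A → Prop) (hS : Equivalence S)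
    (hadd : ∀ a b u, S a b → S (a + u) (b + u)) : AddCon A where
  r := S
  iseqv := hS
  add' {a b c d} hab hcd := by
    refine hS.trans (hadd a b c hab) ?_
    rw [add_comm b c, add_comm b d]
    exact hadd c d b hcd

/-- To check that the congruence generated by `ρ` is contained in a relation it suffices that this
relation is a translation-closed equivalence containing `ρ`. -/
theorem genCon_induction {S : (ι → ℕ) → (ι → ℕ) → Prop} (hS : Equivalence S)
    (hadd : ∀ a b u, S a b → S (a + u) (b + u)) (hρ : ∀ a b, (a, b) ∈ ρ → S a b)
    (h : genCon ρ z z') : S z z' :=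
  (AddCon.addConGen_le (c := AddCon.ofTranslation S hS hadd)).2 hρ h

theorem genCon_of_mem (h : (z, z') ∈ ρ) : genCon ρ z z' := AddConGen.Rel.of _ _ h

theorem sInter_eq_genCon (ρ : Set ((ι → ℕ) × (ι → ℕ))) :
    ⋂₀ {C : Set ((ι → ℕ) × (ι → ℕ)) | ρ ⊆ C ∧ (∀ a, (a, a) ∈ C) ∧
      (∀ a b, (a, b) ∈ C → (b, a) ∈ C) ∧
      (∀ a b c, (a, b) ∈ C → (b, c) ∈ C → (a, c) ∈ C) ∧
      (∀ a b u, (a, b) ∈ C → (a + u, b + u) ∈ C)} = {q | genCon ρ q.1 q.2} := by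
  apply Set.Subset.antisymm
  · refine Set.sInter_subset_of_mem ⟨fun q hq => genCon_of_mem hq, fun a => (genCon ρ).refl a,
      fun a b => (genCon ρ).symm, fun a b c => (genCon ρ).trans,
      fun a b u h => (genCon ρ).add h ((genCon ρ).refl u)⟩
  · rintro ⟨a, b⟩ hab C ⟨hρ, hrefl, hsymm, htrans, hadd⟩
    exact genCon_induction (S := fun a b => (a, b) ∈ C)
      ⟨hrefl, fun h => hsymm _ _ h, fun h h' => htrans _ _ _ h h'⟩ hadd (fun _ _ h => hρ h) hab

end GeneratedCongruence

section ShiftedFamily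

variable {ι : Type*} [Fintype ι] {w r : ι → ℕ} {s t : ι} {p M N : ℕ} {z z' : ι → ℕ}
  {ρ : Set ((ι → ℕ) × (ι → ℕ))}

/-- The value at `z` of the homomorphism `π_N` whose generators are `w i * N + r i`. -/
def value (w r : ι → ℕ) (N : ℕ) (z : ι → ℕ) : ℕ := N * (z ⬝ᵥ w) + z ⬝ᵥ r

/-- The relation of having equal images under every `π_N`. -/
def Homogeneous (w r : ι → ℕ) (x y : ι → ℕ) : Prop := x ⬝ᵥ w = y ⬝ᵥ w ∧ x ⬝ᵥ r = y ⬝ᵥ r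

/-- The pairs in `ρ` of equal weighted length. -/
def homPart (w : ι → ℕ) (ρ : Set ((ι → ℕ) × (ι → ℕ))) : Set ((ι → ℕ) × (ι → ℕ)) :=
  {q ∈ ρ | q.1 ⬝ᵥ w = q.2 ⬝ᵥ w}

/-- The weighted lengths of `z'` and `z` are consecutive among the factorizations of an element. -/
def Consecutive (w r : ι → ℕ) (N : ℕ) (z z' : ι → ℕ) : Prop :=
  value w r N z = value w r N z' ∧ z' ⬝ᵥ w < z ⬝ᵥ w ∧
    ∀ y, value w r N y = value w r N z → y ⬝ᵥ w ≤ z' ⬝ᵥ w ∨ z ⬝ᵥ w ≤ y ⬝ᵥ w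

/-- A translate of a pair in `ρ` joins a factorization of the same element and length as `x` with
one of the same length as `y`. -/
def Crosses (w r : ι → ℕ) (ρ : Set ((ι → ℕ) × (ι → ℕ))) (N : ℕ) (x y : ι → ℕ) : Prop :=
  ∃ a b u, ((a, b) ∈ ρ ∨ (b, a) ∈ ρ) ∧ value w r N (a + u) = value w r N x ∧
    (a + u) ⬝ᵥ w = x ⬝ᵥ w ∧ (b + u) ⬝ᵥ w = y ⬝ᵥ w

/-- The slopes `r i / w i` lie between those of `s` and `t`; `p` is the determinant of the
vectors at `s` and `t`, and `M` bounds the other determinants. -/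
structure ShiftedFamily (w r : ι → ℕ) (s t : ι) (p M : ℕ) : Prop where
  ne : s ≠ t
  pos : ∀ i, 0 < w i
  det : p + w t * r s = w s * r t
  le_left : ∀ i, w i * r s ≤ w s * r i
  le_right : ∀ i, w t * r i ≤ w i * r t
  left_bound : ∀ i, w s * r i - w i * r s ≤ w s * M
  right_bound : ∀ i, w i * r t - w t * r i ≤ M

/-- The parameter `N` is large enough for the presentations to be in their stable range. -/
structure StableRange (p M N : ℕ) : Prop where
  le : p + M * p ≤ N + M
  lt : M * p < N

theorem StableRange.add (hN : StableRange p M N) (m : ℕ) : StableRange p M (N + m) :=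
  ⟨by have := hN.le; lia, by have := hN.lt; lia⟩

theorem value_add (z u : ι → ℕ) : value w r N (z + u) = value w r N z + value w r N u := by
  simp only [value, add_dotProduct]
  ring

theorem value_shift (N p : ℕ) (z : ι → ℕ) :
    value w r (N + p) z = value w r N z + p * (z ⬝ᵥ w) := by
  simp only [value]
  ring

theorem Homogeneous.value_eq (h : Homogeneous w r z z') (N : ℕ) :
    value w r N z = value w r N z' := by
  simp only [value, h.1, h.2]

theorem homogeneous_of_value_eq (h : value w r N z = value w r N z')
    (hw : z ⬝ᵥ w = z' ⬝ᵥ w) : Homogeneous w r z z' := by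
  refine ⟨hw, ?_⟩
  simp only [value, hw] at h
  lia

/-- Homogeneity as a congruence relation. -/
def homogeneousCon (w r : ι → ℕ) : AddCon (ι → ℕ) where
  r := Homogeneous w r
  iseqv := ⟨fun _ => ⟨rfl, rfl⟩, fun h => ⟨h.1.symm, h.2.symm⟩,
    fun h h' => ⟨h.1.trans h'.1, h.2.trans h'.2⟩⟩
  add' h h' := by
    simp only [Homogeneous, add_dotProduct, h.1, h.2, h'.1, h'.2, and_self]

theorem value_eq_of_genCon (hρ : ∀ a b, (a, b) ∈ ρ → value w r N a = value w r N b)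
    (h : genCon ρ z z') : value w r N z = value w r N z' :=
  genCon_induction (S := fun a b => value w r N a = value w r N b)
    ⟨fun _ => rfl, Eq.symm, Eq.trans⟩ (fun a b u h => by rw [value_add, value_add, h]) hρ h

/-- Within elements whose factorizations all have the same length only the homogeneous part of
`ρ` is used. -/
theorem genCon_homPart (hρ : ∀ a b, (a, b) ∈ ρ → value w r N a = value w r N b)
    (h : genCon ρ z z') (hz : ∀ y, value w r N y = value w r N z → y ⬝ᵥ w = z ⬝ᵥ w) :
    genCon (homPart w ρ) z z' := by
  refine (genCon_induction (S := fun a b => value w r N a = value w r N b ∧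
    ((∀ y, value w r N y = value w r N a → y ⬝ᵥ w = a ⬝ᵥ w) → genCon (homPart w ρ) a b))
    ⟨fun a => ⟨rfl, fun _ => (genCon _).refl a⟩, fun {a b} h => ⟨h.1.symm, fun hb => ?_⟩,
      fun {a b c} h h' => ⟨h.1.trans h'.1, fun ha => ?_⟩⟩ (fun a b u h => ⟨?_, fun ha => ?_⟩)
    (fun a b hab => ⟨hρ a b hab, fun ha => ?_⟩) h).2 hz
  · refine (genCon _).symm (h.2 fun y hy => ?_)
    rw [hb y (hy.trans h.1), hb a h.1]
  · refine (genCon _).trans (h.2 ha) (h'.2 fun y hy => ?_)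
    rw [ha y (hy.trans h.1.symm), ha b h.1.symm]
  · rw [value_add, value_add, h.1]
  · refine (genCon _).add (h.2 fun y hy => ?_) ((genCon _).refl u)
    have := ha (y + u) (by rw [value_add, value_add, hy])
    simpa only [add_dotProduct, add_left_inj] using this
  · exact genCon_of_mem ⟨hab, (ha b (hρ a b hab).symm).symm⟩

/-- If an element has factorizations of exactly two lengths, connected through `ρ`, then some pair
of `ρ` joins them. -/
theorem crosses_of_genCon (hρ : ∀ a b, (a, b) ∈ ρ → value w r N a = value w r N b)
    (h : genCon ρ z z') (hne : z ⬝ᵥ w ≠ z' ⬝ᵥ w)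
    (htwo : ∀ y, value w r N y = value w r N z → y ⬝ᵥ w = z ⬝ᵥ w ∨ y ⬝ᵥ w = z' ⬝ᵥ w) :
    Crosses w r ρ N z z' := by
  by_contra hcross
  have key : ∀ a b u, ((a, b) ∈ ρ ∨ (b, a) ∈ ρ) → value w r N (a + u) = value w r N z →
      (a + u) ⬝ᵥ w = z ⬝ᵥ w → (b + u) ⬝ᵥ w = z ⬝ᵥ w := by
    intro a b u hab hv hl
    have hvab : value w r N a = value w r N b := hab.elim (hρ a b) fun h => (hρ b a h).symm
    refine (htwo (b + u) ?_).resolve_right fun hb => hcross ⟨a, b, u, hab, hv, hl, hb⟩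
    rw [← hv, value_add, value_add, hvab]
  refine hne.symm ?_
  have := (genCon_induction (S := fun a b => value w r N a = value w r N b ∧
    ∀ u, value w r N (a + u) = value w r N z →
      ((a + u) ⬝ᵥ w = z ⬝ᵥ w ↔ (b + u) ⬝ᵥ w = z ⬝ᵥ w))
    ⟨fun a => ⟨rfl, fun _ _ => Iff.rfl⟩, fun {a b} h => ⟨h.1.symm, fun u hu => (h.2 u ?_).symm⟩,
      fun {a b c} h h' => ⟨h.1.trans h'.1, fun u hu => (h.2 u hu).trans (h'.2 u ?_)⟩⟩
    (fun a b u h => ⟨?_, fun v hv => ?_⟩) (fun a b hab => ⟨hρ a b hab, fun u hu =>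
      ⟨key a b u (.inl hab) hu, key b a u (.inr hab) ?_⟩⟩) h).2 0 (by rw [add_zero])
  · simpa using this
  · rw [← hu, value_add, value_add, h.1]
  · rw [← hu, value_add, value_add, h.1]
  · rw [value_add, value_add, h.1]
  · rw [add_assoc] at hv ⊢
    rw [add_assoc]
    exact h.2 _ hv
  · rw [← hu, value_add, value_add, hρ a b hab]

theorem Crosses.congr {y y' : ι → ℕ} (h : Crosses w r ρ N y y')
    (hz : Homogeneous w r z y) (hz' : Homogeneous w r z' y') : Crosses w r ρ N z z' := by
  obtain ⟨a, b, u, hab, h1, h2, h3⟩ := h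
  exact ⟨a, b, u, hab, h1.trans (hz.value_eq N).symm, h2.trans hz.1.symm, h3.trans hz'.1.symm⟩

theorem Crosses.add (h : Crosses w r ρ N z z') (v : ι → ℕ) :
    Crosses w r ρ N (z + v) (z' + v) := by
  obtain ⟨a, b, u, hab, h1, h2, h3⟩ := h
  refine ⟨a, b, u + v, hab, ?_, ?_, ?_⟩
  · rw [← add_assoc, value_add, h1, value_add]
  · rw [← add_assoc, add_dotProduct, h2, add_dotProduct]
  · rw [← add_assoc, add_dotProduct, h3, add_dotProduct]

theorem Consecutive.congr {y y' : ι → ℕ} (h : Consecutive w r N z z')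
    (hz : Homogeneous w r z y) (hz' : Homogeneous w r z' y') : Consecutive w r N y y' := by
  simpa only [Consecutive, ← hz.value_eq N, ← hz'.value_eq N, ← hz.1, ← hz'.1] using h

theorem Consecutive.of_add {v : ι → ℕ} (h : Consecutive w r N (z + v) (z' + v)) :
    Consecutive w r N z z' := by
  obtain ⟨h1, h2, h3⟩ := h
  simp only [value_add, add_dotProduct, add_left_inj, add_lt_add_iff_right] at h1 h2 h3
  refine ⟨h1, h2, fun y hy => ?_⟩
  have := h3 (y + v) (by rw [value_add, hy])
  simpa only [add_dotProduct, add_le_add_iff_right] using this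

theorem dotProduct_le_sum {c : ι → ℕ} {K : ℕ} (hc : ∀ i, c i ≤ K) (z : ι → ℕ) :
    z ⬝ᵥ c ≤ K * ∑ i, z i := by
  rw [dotProduct, mul_sum]
  refine sum_le_sum fun i _ => ?_
  rw [mul_comm]
  exact Nat.mul_le_mul_right _ (hc i)

namespace ShiftedFamily

theorem dotProduct_right (F : ShiftedFamily w r s t p M) (z : ι → ℕ) :
    r t * (z ⬝ᵥ w) = w t * (z ⬝ᵥ r) + z ⬝ᵥ fun i => w i * r t - w t * r i := by
  simp only [dotProduct, mul_sum, ← sum_add_distrib]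
  refine sum_congr rfl fun i _ => ?_
  obtain ⟨c, hc⟩ := Nat.exists_eq_add_of_le (F.le_right i)
  rw [hc, Nat.add_sub_cancel_left]
  linear_combination z i * hc

theorem dotProduct_left (F : ShiftedFamily w r s t p M) (z : ι → ℕ) :
    w s * (z ⬝ᵥ r) = r s * (z ⬝ᵥ w) + z ⬝ᵥ fun i => w s * r i - w i * r s := by
  simp only [dotProduct, mul_sum, ← sum_add_distrib]
  refine sum_congr rfl fun i _ => ?_
  obtain ⟨c, hc⟩ := Nat.exists_eq_add_of_le (F.le_left i)
  rw [hc, Nat.add_sub_cancel_left]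
  linear_combination z i * hc

theorem le_dotProduct_right (F : ShiftedFamily w r s t p M)
    (h : value w r N z = value w r N z') {l : ℕ} (hl : z ⬝ᵥ w = z' ⬝ᵥ w + l) :
    l * (w t * N + r t) ≤ z ⬝ᵥ fun i => w i * r t - w t * r i := by
  have h1 := F.dotProduct_right z
  have h2 := F.dotProduct_right z'
  simp only [value] at h
  rw [hl] at h h1
  nlinarith

theorem le_dotProduct_left (F : ShiftedFamily w r s t p M)
    (h : value w r N z = value w r N z') {l : ℕ} (hl : z' ⬝ᵥ w = z ⬝ᵥ w + l) :
    l * (w s * N + r s) ≤ z ⬝ᵥ fun i => w s * r i - w i * r s := by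
  have h1 := F.dotProduct_left z
  have h2 := F.dotProduct_left z'
  simp only [value] at h
  rw [hl] at h h2
  nlinarith

/-- A factorization with at most `p` terms has no mates of different weighted length. -/
theorem dotProduct_eq_of_sum_le (F : ShiftedFamily w r s t p M) (hN : StableRange p M N)
    (hz : ∑ i, z i ≤ p) (h : value w r N z = value w r N z') : z ⬝ᵥ w = z' ⬝ᵥ w := by
  rcases lt_trichotomy (z ⬝ᵥ w) (z' ⬝ᵥ w) with hlt | heq | hlt
  · obtain ⟨l, hl⟩ := Nat.exists_eq_add_of_lt hlt
    have h1 := F.le_dotProduct_left h (l := l + 1) hl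
    have h2 := h1.trans (dotProduct_le_sum F.left_bound z)
    have h3 : w s * M * ∑ i, z i ≤ w s * M * p := by gcongr
    have h4 : w s * (M * p) < w s * N := Nat.mul_lt_mul_of_pos_left hN.lt (F.pos s)
    have h5 : w s * N ≤ (l + 1) * (w s * N + r s) :=
      le_self_add.trans (Nat.le_mul_of_pos_left _ l.succ_pos)
    rw [mul_assoc] at h3
    lia
  · exact heq
  · obtain ⟨l, hl⟩ := Nat.exists_eq_add_of_lt hlt
    have h1 := F.le_dotProduct_right h (l := l + 1) hl
    have h2 := h1.trans (dotProduct_le_sum F.right_bound z)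
    have h3 : M * ∑ i, z i ≤ M * p := by gcongr
    have h4 : N ≤ w t * N := Nat.le_mul_of_pos_left N (F.pos t)
    have h5 := hN.lt
    nlinarith

theorem pos_of_dotProduct_ne (F : ShiftedFamily w r s t p M) (hN : StableRange p M N)
    (h : value w r N z = value w r N z') (hne : z ⬝ᵥ w ≠ z' ⬝ᵥ w) : 0 < p := by
  wlog hlt : z' ⬝ᵥ w < z ⬝ᵥ w generalizing z z'
  · exact this h.symm hne.symm (by lia)
  by_contra! hp
  obtain rfl : p = 0 := by lia
  have hdet := F.det
  obtain ⟨l, hl⟩ := Nat.exists_eq_add_of_lt hlt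
  have h1 := F.le_dotProduct_right h (l := l + 1) hl
  have h2 : ∀ i, w i * r t - w t * r i = 0 := by
    intro i
    rw [Nat.sub_eq_zero_iff_le]
    have h3 := Nat.mul_le_mul_left (w t) (F.le_left i)
    refine Nat.le_of_mul_le_mul_left ?_ (F.pos s)
    nlinarith
  simp only [h2, dotProduct, mul_zero, sum_const_zero] at h1
  have h3 := Nat.mul_pos (F.pos t) (Nat.zero_lt_of_lt hN.lt)
  nlinarith

end ShiftedFamily

variable [DecidableEq ι]

/-- The sum of the coordinates of `z` other than `s` and `t`. -/
def offSum (s t : ι) (z : ι → ℕ) : ℕ := ∑ i ∈ ({s, t} : Finset ι)ᶜ, z i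

theorem value_single (N : ℕ) (i : ι) (m : ℕ) :
    value w r N (Pi.single i m) = m * (w i * N + r i) := by
  simp only [value, single_dotProduct]
  ring

theorem dotProduct_le_offSum (hne : s ≠ t) {c : ι → ℕ} {K : ℕ} (hc : ∀ i, c i ≤ K) (z : ι → ℕ) :
    z ⬝ᵥ c ≤ z s * c s + z t * c t + K * offSum s t z := by
  rw [dotProduct, ← sum_add_sum_compl {s, t}, sum_pair hne, offSum, mul_sum]
  refine add_le_add_right (sum_le_sum fun i _ => ?_) _
  rw [mul_comm]
  exact Nat.mul_le_mul_right _ (hc i)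

namespace ShiftedFamily

theorem le_apply_left (F : ShiftedFamily w r s t p M) (hN : StableRange p M N)
    (hz : offSum s t z < p) (h : value w r N z = value w r N z') {l : ℕ}
    (hl : z ⬝ᵥ w = z' ⬝ᵥ w + l) : l * w t ≤ z s := by
  have h1 := (F.le_dotProduct_right h hl).trans (dotProduct_le_offSum F.ne F.right_bound z)
  have h2 : w s * r t - w t * r s = p := by rw [← F.det, Nat.add_sub_cancel]
  have h3 : w t * r t - w t * r t = 0 := Nat.sub_self _
  simp only [h2, h3, mul_zero, add_zero] at h1
  rcases Nat.eq_zero_or_pos l with rfl | hl0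
  · simp
  have h4 : M * offSum s t z + M ≤ M * p := by
    rw [← Nat.mul_succ]
    gcongr
    exact hz
  have h5 := hN.le
  refine Nat.le_of_mul_le_mul_left ?_ (Nat.zero_lt_of_lt hz)
  obtain ⟨m, hm⟩ : ∃ m, N = p + m := Nat.exists_eq_add_of_le (by lia)
  have h6 : m ≤ l * w t * m := Nat.le_mul_of_pos_left m (Nat.mul_pos hl0 (F.pos t))
  subst hm
  nlinarith

theorem le_apply_right (F : ShiftedFamily w r s t p M) (hN : StableRange p M N)
    (hz : offSum s t z < p) (h : value w r N z = value w r N z') {l : ℕ}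
    (hl : z' ⬝ᵥ w = z ⬝ᵥ w + l) : l * w s ≤ z t := by
  have h1 := (F.le_dotProduct_left h hl).trans (dotProduct_le_offSum F.ne F.left_bound z)
  have h2 : w s * r t - w t * r s = p := by rw [← F.det, Nat.add_sub_cancel]
  have h3 : w s * r s - w s * r s = 0 := Nat.sub_self _
  simp only [h2, h3, mul_zero, zero_add] at h1
  rcases Nat.eq_zero_or_pos l with rfl | hl0
  · simp
  have h4 : M * offSum s t z + M ≤ M * p := by
    rw [← Nat.mul_succ]
    gcongr
    exact hz
  have h5 := hN.le
  refine Nat.le_of_mul_le_mul_left ?_ (Nat.zero_lt_of_lt hz)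
  obtain ⟨m, hm⟩ : ∃ m, N = p + m := Nat.exists_eq_add_of_le (by lia)
  subst hm
  have h6 : w s * (M * offSum s t z) ≤ w s * m := by
    gcongr
    lia
  have h7 : w s * m ≤ l * (w s * m) := Nat.le_mul_of_pos_left _ hl0
  nlinarith

/-- A vector of sum at least `p` dominates a nonzero vector with at most `p` terms that is
homogeneously equivalent to one supported on `s` and `t`. -/
theorem exists_le_homogeneous (F : ShiftedFamily w r s t p M) (hp : 0 < p) {f : ι → ℕ}
    (hf : p ≤ ∑ i, f i) :
    ∃ a ≤ f, 0 < ∑ i, a i ∧ ∑ i, a i ≤ p ∧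
      ∃ x y : ℕ, Homogeneous w r a (Pi.single s x + Pi.single t y) := by
  obtain ⟨c, hmono, hle, hsum⟩ := exists_chain_le f p hf
  obtain ⟨i, j, hij, hj, x, y, h1, h2⟩ := exists_lt_sub_mem_lattice (F.pos s) hp F.det
    (fun j => ((c j ⬝ᵥ w : ℕ) : ℤ)) (fun j => ((c j ⬝ᵥ r : ℕ) : ℤ))
  obtain ⟨a, ha⟩ := le_iff_exists_add.1 (hmono hij.le)
  have hsa : i + ∑ l, a l = j := by
    rw [← hsum j hj, ha, ← hsum i (hij.le.trans hj)]
    simp [sum_add_distrib, hsum i (hij.le.trans hj)]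
  simp only [ha, add_dotProduct, Nat.cast_add, add_sub_cancel_left] at h1 h2
  have h3 := F.dotProduct_right a
  have h4 := F.dotProduct_left a
  have h5 := F.det
  zify at h3 h4 h5
  have hp' : (0 : ℤ) < p := by exact_mod_cast hp
  have hx : 0 ≤ x := by
    refine nonneg_of_mul_nonneg_right (a := (p : ℤ)) ?_ hp'
    rw [h1, h2] at h3
    have : (p : ℤ) * x = ((a ⬝ᵥ fun i => w i * r t - w t * r i : ℕ) : ℤ) := by
      linear_combination h3 + x * h5
    rw [this]
    positivity
  have hy : 0 ≤ y := by
    refine nonneg_of_mul_nonneg_right (a := (p : ℤ)) ?_ hp'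
    rw [h1, h2] at h4
    have : (p : ℤ) * y = ((a ⬝ᵥ fun i => w s * r i - w i * r s : ℕ) : ℤ) := by
      linear_combination h4 + y * h5
    rw [this]
    positivity
  lift x to ℕ using hx
  lift y to ℕ using hy
  refine ⟨a, le_trans (ha ▸ le_add_self) (hle j), by lia, by lia, x, y, ?_, ?_⟩
  · simp only [add_dotProduct, single_dotProduct]
    zify
    rw [h1]
    ring
  · simp only [add_dotProduct, single_dotProduct]
    zify
    rw [h2]
    ring

/-- Homogeneous moves with at most `p` terms concentrate any vector on `s` and `t`. -/
theorem exists_offSum_lt (F : ShiftedFamily w r s t p M) (hp : 0 < p) (C : AddCon (ι → ℕ))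
    (hC : ∀ a b, ∑ i, a i ≤ p → Homogeneous w r a b → C a b) (z : ι → ℕ) :
    ∃ y, C z y ∧ Homogeneous w r z y ∧ offSum s t y < p := by
  induction hm : offSum s t z using Nat.strong_induction_on generalizing z with
  | _ m ih =>
  rcases lt_or_ge (offSum s t z) p with hlt | hge
  · exact ⟨z, C.refl z, (homogeneousCon w r).refl z, hlt⟩
  let f : ι → ℕ := fun i => if i ∈ ({s, t} : Finset ι)ᶜ then z i else 0
  have hf : ∑ i, f i = offSum s t z := by
    simp only [f, offSum, sum_ite_mem, univ_inter]
  obtain ⟨a, haf, ha0, hap, x, y, hxy⟩ := F.exists_le_homogeneous hp (hf ▸ hge)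
  have hfz : f ≤ z := by
    intro i
    dsimp only [f]
    split_ifs <;> simp
  have ha : ∀ i ∉ ({s, t} : Finset ι)ᶜ, a i = 0 := fun i hi =>
    Nat.le_zero.1 ((haf i).trans_eq (if_neg hi))
  obtain ⟨b, rfl⟩ := le_iff_exists_add.1 (haf.trans hfz)
  have hlt : offSum s t (Pi.single s x + Pi.single t y + b) < offSum s t (a + b) := by
    have h1 : offSum s t (a + b) = ∑ i, a i + offSum s t b := by
      have : offSum s t a = ∑ i, a i := by
        exact sum_subset (subset_univ _) fun i _ hi => ha i hi
      rw [← this]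
      simp only [offSum, Pi.add_apply, sum_add_distrib]
    have h2 : offSum s t (Pi.single s x + Pi.single t y + b) = offSum s t b := by
      refine sum_congr rfl fun i hi => ?_
      simp only [mem_compl, mem_insert, mem_singleton, not_or] at hi
      simp [hi.1, hi.2]
    lia
  obtain ⟨v, hv1, hv2, hv3⟩ := ih _ (hm ▸ hlt) _ rfl
  exact ⟨v, C.trans (C.add (hC _ _ hap hxy) (C.refl b)) hv1,
    (homogeneousCon w r).trans ((homogeneousCon w r).add hxy ((homogeneousCon w r).refl b)) hv2,
    hv3⟩

theorem exists_homogeneous_offSum_lt (F : ShiftedFamily w r s t p M) (hp : 0 < p) (z : ι → ℕ) :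
    ∃ y, Homogeneous w r z y ∧ offSum s t y < p := by
  obtain ⟨y, -, h⟩ := F.exists_offSum_lt hp (homogeneousCon w r) (fun _ _ _ h => h) z
  exact ⟨y, h⟩

/-- A factorization that is not of minimal length can be moved to one that uses `s`. -/
theorem exists_add_single_left (F : ShiftedFamily w r s t p M) (hN : StableRange p M N)
    (C : AddCon (ι → ℕ)) (hC : ∀ a b, ∑ i, a i ≤ p → Homogeneous w r a b → C a b)
    (h : value w r N z = value w r N z') (hlt : z' ⬝ᵥ w < z ⬝ᵥ w) :
    ∃ x : ι → ℕ, C z (x + Pi.single s 1) ∧ Homogeneous w r z (x + Pi.single s 1) := by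
  obtain ⟨y, h1, h2, h3⟩ := F.exists_offSum_lt (F.pos_of_dotProduct_ne hN h hlt.ne') C hC z
  obtain ⟨l, hl⟩ := Nat.exists_eq_add_of_lt hlt
  have h4 := F.le_apply_left hN h3 ((h2.value_eq N).symm.trans h) (l := l + 1) (h2.1 ▸ hl)
  have h5 : 1 ≤ y s := le_trans (Nat.mul_pos l.succ_pos (F.pos t)) h4
  obtain ⟨x, rfl⟩ := exists_eq_add_single h5
  exact ⟨x, h1, h2⟩

/-- A factorization that is not of maximal length can be moved to one that uses `t`. -/
theorem exists_add_single_right (F : ShiftedFamily w r s t p M) (hN : StableRange p M N)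
    (C : AddCon (ι → ℕ)) (hC : ∀ a b, ∑ i, a i ≤ p → Homogeneous w r a b → C a b)
    (h : value w r N z = value w r N z') (hlt : z ⬝ᵥ w < z' ⬝ᵥ w) :
    ∃ x : ι → ℕ, C z (x + Pi.single t 1) ∧ Homogeneous w r z (x + Pi.single t 1) := by
  obtain ⟨y, h1, h2, h3⟩ := F.exists_offSum_lt (F.pos_of_dotProduct_ne hN h hlt.ne) C hC z
  obtain ⟨l, hl⟩ := Nat.exists_eq_add_of_lt hlt
  have h4 := F.le_apply_right hN h3 ((h2.value_eq N).symm.trans h) (l := l + 1) (h2.1 ▸ hl)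
  have h5 : 1 ≤ y t := le_trans (Nat.mul_pos l.succ_pos (F.pos s)) h4
  obtain ⟨x, rfl⟩ := exists_eq_add_single h5
  exact ⟨x, h1, h2⟩

theorem value_lt_add_single (F : ShiftedFamily w r s t p M) (hN : StableRange p M N)
    (x : ι → ℕ) (i : ι) : value w r N x < value w r N (x + Pi.single i 1) := by
  have := Nat.mul_pos (F.pos i) (Nat.zero_lt_of_lt hN.lt)
  rw [value_add, value_single]
  lia

theorem genCon_homPart_of_homogeneous (F : ShiftedFamily w r s t p M) (hN : StableRange p M N)
    (hρ : ∀ a b, genCon ρ a b ↔ value w r N a = value w r N b) (h : Homogeneous w r z z') :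
    genCon (homPart w ρ) z z' := by
  have hmem : ∀ a b, (a, b) ∈ ρ → value w r N a = value w r N b :=
    fun a b h => (hρ a b).1 (genCon_of_mem h)
  have hC : ∀ a b, ∑ i, a i ≤ p → Homogeneous w r a b → genCon (homPart w ρ) a b :=
    fun a b ha hab => genCon_homPart hmem ((hρ a b).2 (hab.value_eq N)) fun y hy =>
      (F.dotProduct_eq_of_sum_le hN ha hy.symm).symm
  induction hm : value w r N z using Nat.strong_induction_on generalizing z z' with
  | _ m ih =>
  have step : ∀ (i : ι) (x x' : ι → ℕ), Homogeneous w r z (x + Pi.single i 1) →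
      Homogeneous w r z' (x' + Pi.single i 1) → genCon (homPart w ρ) z (x + Pi.single i 1) →
      genCon (homPart w ρ) z' (x' + Pi.single i 1) → genCon (homPart w ρ) z z' := by
    intro i x x' h1 h2 c1 c2
    refine (genCon _).trans c1 ((genCon _).trans ((genCon _).add ?_ ((genCon _).refl _))
      ((genCon _).symm c2))
    refine ih _ ?_ ?_ rfl
    · rw [← hm, h1.value_eq N]
      exact F.value_lt_add_single hN x i
    · have h3 := ((homogeneousCon w r).symm h1).1.trans (h.1.trans h2.1)
      have h4 := ((homogeneousCon w r).symm h1).2.trans (h.2.trans h2.2)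
      simp only [add_dotProduct, add_left_inj] at h3 h4
      exact ⟨h3, h4⟩
  by_cases hsingle : ∀ y, value w r N y = value w r N z → y ⬝ᵥ w = z ⬝ᵥ w
  · exact genCon_homPart hmem ((hρ z z').2 (h.value_eq N)) hsingle
  push Not at hsingle
  obtain ⟨y, hy, hne⟩ := hsingle
  rcases lt_or_gt_of_ne hne with hlt | hlt
  · obtain ⟨x, c1, h1⟩ := F.exists_add_single_left hN _ hC hy.symm hlt
    obtain ⟨x', c2, h2⟩ := F.exists_add_single_left hN _ hC
      ((h.value_eq N).symm.trans hy.symm) (h.1 ▸ hlt)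
    exact step s x x' h1 h2 c1 c2
  · obtain ⟨x, c1, h1⟩ := F.exists_add_single_right hN _ hC hy.symm hlt
    obtain ⟨x', c2, h2⟩ := F.exists_add_single_right hN _ hC
      ((h.value_eq N).symm.trans hy.symm) (h.1 ▸ hlt)
    exact step t x x' h1 h2 c1 c2

theorem crosses_of_consecutive (F : ShiftedFamily w r s t p M) (hN : StableRange p M N)
    (hρ : ∀ a b, genCon ρ a b ↔ value w r N a = value w r N b) (h : Consecutive w r N z z') :
    Crosses w r ρ N z z' := by
  have hmem : ∀ a b, (a, b) ∈ ρ → value w r N a = value w r N b :=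
    fun a b h => (hρ a b).1 (genCon_of_mem h)
  induction hm : value w r N z using Nat.strong_induction_on generalizing z z' with
  | _ m ih =>
  have step : ∀ (i : ι) (x x' : ι → ℕ), Homogeneous w r z (x + Pi.single i 1) →
      Homogeneous w r z' (x' + Pi.single i 1) → Crosses w r ρ N z z' := by
    intro i x x' h1 h2
    refine Crosses.congr (Crosses.add (ih _ ?_ (h.congr h1 h2).of_add rfl) _) h1 h2
    rw [← hm, h1.value_eq N]
    exact F.value_lt_add_single hN x i
  by_cases htwo : ∀ y, value w r N y = value w r N z → y ⬝ᵥ w = z ⬝ᵥ w ∨ y ⬝ᵥ w = z' ⬝ᵥ w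
  · exact crosses_of_genCon hmem ((hρ z z').2 h.1) h.2.1.ne' htwo
  push Not at htwo
  obtain ⟨y, hy, hne, hne'⟩ := htwo
  have hlt := h.2.1
  rcases h.2.2 y hy with hle | hle
  · obtain ⟨x, -, h1⟩ := F.exists_add_single_left hN (homogeneousCon w r) (fun _ _ _ h => h)
      hy.symm (by lia)
    obtain ⟨x', -, h2⟩ := F.exists_add_single_left hN (homogeneousCon w r) (fun _ _ _ h => h)
      (h.1.symm.trans hy.symm) (by lia)
    exact step s x x' h1 h2
  · obtain ⟨x, -, h1⟩ := F.exists_add_single_right hN (homogeneousCon w r) (fun _ _ _ h => h)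
      hy.symm (by lia)
    obtain ⟨x', -, h2⟩ := F.exists_add_single_right hN (homogeneousCon w r) (fun _ _ _ h => h)
      (h.1.symm.trans hy.symm) (by lia)
    exact step t _ _ h1 h2

/-- In the stable range a set of pairs is a presentation exactly when its homogeneous part
generates all homogeneous pairs and it joins all consecutive lengths. -/
theorem presentation_iff (F : ShiftedFamily w r s t p M) (hN : StableRange p M N)
    (hmem : ∀ a b, (a, b) ∈ ρ → value w r N a = value w r N b) :
    (∀ a b, genCon ρ a b ↔ value w r N a = value w r N b) ↔
      (∀ a b, Homogeneous w r a b → genCon (homPart w ρ) a b) ∧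
        ∀ a b, Consecutive w r N a b → Crosses w r ρ N a b := by
  refine ⟨fun h => ⟨fun a b => F.genCon_homPart_of_homogeneous hN h,
    fun a b => F.crosses_of_consecutive hN h⟩, fun ⟨hhom, hcross⟩ a b =>
    ⟨value_eq_of_genCon hmem, fun hab => ?_⟩⟩
  have hhom' : ∀ a b, Homogeneous w r a b → genCon ρ a b := fun a b h =>
    AddCon.addConGen_mono (fun _ _ h => h.1) (hhom a b h)
  wlog hle : b ⬝ᵥ w ≤ a ⬝ᵥ w generalizing a b
  · exact (genCon ρ).symm (this b a hab.symm (by lia))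
  induction hm : a ⬝ᵥ w - b ⬝ᵥ w using Nat.strong_induction_on generalizing a b with
  | _ m ih =>
  rcases hle.eq_or_lt with heq | hlt
  · exact hhom' a b (homogeneous_of_value_eq hab heq.symm)
  by_cases hcons : ∀ y, value w r N y = value w r N a → y ⬝ᵥ w ≤ b ⬝ᵥ w ∨ a ⬝ᵥ w ≤ y ⬝ᵥ w
  · obtain ⟨c, d, u, hcd, h1, h2, h3⟩ := hcross a b ⟨hab, hlt, hcons⟩
    have hcd' : genCon ρ c d :=
      hcd.elim genCon_of_mem fun h => (genCon ρ).symm (genCon_of_mem h)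
    have hv : value w r N (d + u) = value w r N b := by
      rw [← hab, ← h1, value_add, value_add, value_eq_of_genCon hmem hcd']
    exact (genCon ρ).trans (hhom' _ _ (homogeneous_of_value_eq h1.symm h2.symm))
      ((genCon ρ).trans ((genCon ρ).add hcd' ((genCon ρ).refl u))
        (hhom' _ _ (homogeneous_of_value_eq hv h3)))
  · push Not at hcons
    obtain ⟨y, hy, hby, hya⟩ := hcons
    exact (genCon ρ).trans (ih _ (by lia) a y hy.symm hya.le rfl)
      (ih _ (by lia) y b (hy.trans hab) hby.le rfl)

end ShiftedFamily

/-- The map carrying a pair of factorizations with equal values to such a pair for the shifted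
parameter, with the length difference compensated at `s` and `t`. -/
def shiftPair (w : ι → ℕ) (s t : ι) (q : (ι → ℕ) × (ι → ℕ)) : (ι → ℕ) × (ι → ℕ) :=
  if q.2 ⬝ᵥ w < q.1 ⬝ᵥ w then
    (q.1 + Pi.single s ((q.1 ⬝ᵥ w - q.2 ⬝ᵥ w) * w t),
      q.2 + Pi.single t ((q.1 ⬝ᵥ w - q.2 ⬝ᵥ w) * w s))
  else if q.1 ⬝ᵥ w < q.2 ⬝ᵥ w then
    (q.1 + Pi.single t ((q.2 ⬝ᵥ w - q.1 ⬝ᵥ w) * w s),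
      q.2 + Pi.single s ((q.2 ⬝ᵥ w - q.1 ⬝ᵥ w) * w t))
  else q

theorem shiftPair_of_eq_add {l : ℕ} (hl : z ⬝ᵥ w = z' ⬝ᵥ w + l) :
    shiftPair w s t (z, z') = (z + Pi.single s (l * w t), z' + Pi.single t (l * w s)) := by
  rcases Nat.eq_zero_or_pos l with rfl | hl0
  · simp [shiftPair, hl]
  · simp [shiftPair, hl, hl0]

theorem shiftPair_swap (q : (ι → ℕ) × (ι → ℕ)) :
    shiftPair w s t q.swap = (shiftPair w s t q).swap := by
  rcases lt_trichotomy (q.1 ⬝ᵥ w) (q.2 ⬝ᵥ w) with h | h | h <;>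
  simp [shiftPair, h, h.not_gt]

namespace ShiftedFamily

theorem value_interpolate_iff (F : ShiftedFamily w r s t p M) (N : ℕ) {y v : ι → ℕ} {l m : ℕ}
    (hy : y ⬝ᵥ w = v ⬝ᵥ w + m) :
    value w r (N + p) (v + Pi.single s (l * w t) + Pi.single t (m * w s)) =
      value w r (N + p) (y + Pi.single s ((l + m) * w t)) ↔ value w r N v = value w r N y := by
  have key : p + w t * (w s * (N + p) + r s) = w s * (w t * (N + p) + r t) := by
    linear_combination F.det
  have h1 : value w r (N + p) (v + Pi.single s (l * w t) + Pi.single t (m * w s)) =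
      value w r N v + (p * (v ⬝ᵥ w + m) + (l + m) * w t * (w s * (N + p) + r s)) := by
    simp only [value_add, value_single, value_shift]
    linear_combination m * key.symm
  have h2 : value w r (N + p) (y + Pi.single s ((l + m) * w t)) =
      value w r N y + (p * (v ⬝ᵥ w + m) + (l + m) * w t * (w s * (N + p) + r s)) := by
    simp only [value_add, value_single, value_shift, hy]
    ring
  rw [h1, h2, Nat.add_right_cancel_iff]

theorem value_shiftPair_iff (F : ShiftedFamily w r s t p M) (N : ℕ) {l : ℕ}
    (hl : z ⬝ᵥ w = z' ⬝ᵥ w + l) :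
    value w r (N + p) (z + Pi.single s (l * w t)) =
      value w r (N + p) (z' + Pi.single t (l * w s)) ↔ value w r N z = value w r N z' := by
  have := F.value_interpolate_iff N (l := 0) hl
  simp only [zero_mul, Pi.single_zero, add_zero, zero_add] at this
  rw [eq_comm, this, eq_comm]

theorem value_eq_of_mem_image (F : ShiftedFamily w r s t p M)
    (hmem : ∀ a b, (a, b) ∈ ρ → value w r N a = value w r N b) (a b : ι → ℕ)
    (h : (a, b) ∈ shiftPair w s t '' ρ) : value w r (N + p) a = value w r (N + p) b := by
  obtain ⟨⟨c, d⟩, hcd, heq⟩ := h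
  have hv := hmem c d hcd
  wlog hle : d ⬝ᵥ w ≤ c ⬝ᵥ w generalizing a b c d ρ
  · refine (this (ρ := {(d, c)}) ?_ b a d c rfl ?_ hv.symm (by lia)).symm
    · rintro _ _ ⟨⟩
      exact hv.symm
    · rw [← Prod.swap_prod_mk (a := c), shiftPair_swap, heq, Prod.swap_prod_mk]
  obtain ⟨l, hl⟩ := Nat.exists_eq_add_of_le hle
  rw [shiftPair_of_eq_add hl, Prod.mk.injEq] at heq
  obtain ⟨rfl, rfl⟩ := heq
  exact (F.value_shiftPair_iff N hl).2 hv

end ShiftedFamily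

theorem dotProduct_shiftPair_eq_iff (q : (ι → ℕ) × (ι → ℕ)) :
    (shiftPair w s t q).1 ⬝ᵥ w = (shiftPair w s t q).2 ⬝ᵥ w ↔ q.1 ⬝ᵥ w = q.2 ⬝ᵥ w := by
  obtain ⟨c, d⟩ := q
  wlog hle : d ⬝ᵥ w ≤ c ⬝ᵥ w generalizing c d
  · have := this d c (by lia)
    rw [← Prod.swap_prod_mk (a := c), shiftPair_swap] at this
    rw [eq_comm, eq_comm (a := (c, d).1 ⬝ᵥ w)]
    exact this
  obtain ⟨l, hl⟩ := Nat.exists_eq_add_of_le hle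
  rw [shiftPair_of_eq_add hl]
  simp only [add_dotProduct, single_dotProduct, hl]
  rw [mul_right_comm]
  lia

theorem homPart_image_shiftPair (ρ : Set ((ι → ℕ) × (ι → ℕ))) :
    homPart w (shiftPair w s t '' ρ) = homPart w ρ := by
  have hid : ∀ q : (ι → ℕ) × (ι → ℕ), q.1 ⬝ᵥ w = q.2 ⬝ᵥ w → shiftPair w s t q = q := by
    intro q hq
    simp [shiftPair, hq]
  ext q
  constructor
  · rintro ⟨⟨q', hq', rfl⟩, h⟩
    rw [dotProduct_shiftPair_eq_iff] at h
    rw [hid q' h]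
    exact ⟨hq', h⟩
  · rintro ⟨hq, h⟩
    exact ⟨⟨q, hq, hid q h⟩, h⟩

namespace ShiftedFamily

variable {l : ℕ}

theorem consecutive_shift_iff (F : ShiftedFamily w r s t p M) (hN : StableRange p M N)
    (hl : z ⬝ᵥ w = z' ⬝ᵥ w + l) :
    Consecutive w r (N + p) (z + Pi.single s (l * w t)) (z' + Pi.single t (l * w s)) ↔
      Consecutive w r N z z' := by
  have hz : (z + Pi.single s (l * w t)) ⬝ᵥ w = z ⬝ᵥ w + l * w t * w s := by
    rw [add_dotProduct, single_dotProduct]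
  have hz' : (z' + Pi.single t (l * w s)) ⬝ᵥ w = z' ⬝ᵥ w + l * w t * w s := by
    rw [add_dotProduct, single_dotProduct, mul_right_comm]
  have hmid : ∀ (v : ι → ℕ) (c d : ℕ), c + d = l →
      (v + Pi.single s (c * w t) + Pi.single t (d * w s)) ⬝ᵥ w = v ⬝ᵥ w + l * w t * w s := by
    intro v c d hcd
    rw [add_dotProduct, add_dotProduct, single_dotProduct, single_dotProduct, ← hcd]
    ring
  rw [Consecutive, Consecutive, F.value_shiftPair_iff N hl, hz, hz', Nat.add_lt_add_iff_right]
  refine and_congr_right fun hv => and_congr_right fun hlt => ?_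
  constructor
  · intro h y hy
    by_contra! hcon
    obtain ⟨d, hd⟩ := Nat.exists_eq_add_of_le hcon.2.le
    obtain ⟨c, hc⟩ := Nat.exists_eq_add_of_le hcon.1.le
    obtain rfl : l = c + d := by lia
    have := h _ ((F.value_interpolate_iff N hd).2 hy)
    rw [hmid y c d rfl] at this
    lia
  · intro h x hx
    by_contra! hcon
    obtain ⟨d, hd⟩ := Nat.exists_eq_add_of_le hcon.2.le
    obtain ⟨c, hc⟩ := Nat.exists_eq_add_of_le hcon.1.le
    obtain rfl : l = c + d := by lia
    have hp := F.pos_of_dotProduct_ne hN hv hlt.ne'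
    obtain ⟨y, hxy, hy⟩ := F.exists_homogeneous_offSum_lt hp x
    have hyx := (hxy.value_eq (N + p)).symm.trans hx
    have h1 := F.le_apply_left (hN.add p) hy (hyx.trans ((F.value_shiftPair_iff N hl).2 hv))
      (l := c) (by rw [hz', ← hxy.1, hc])
    have h2 := F.le_apply_right (hN.add p) hy hyx (l := d) (by rw [hz, ← hxy.1, hd])
    obtain ⟨y, rfl⟩ := exists_eq_add_single h2
    obtain ⟨v, rfl⟩ := exists_eq_add_single (by simpa [F.ne] using h1 : c * w t ≤ y s)
    have hv1 := hxy.1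
    rw [hmid v c d rfl] at hv1
    have := h v ((F.value_interpolate_iff N (by lia)).1 hyx)
    lia

theorem crosses_shift_iff (N p : ℕ) (hl : z ⬝ᵥ w = z' ⬝ᵥ w + l) :
    Crosses w r (shiftPair w s t '' ρ) (N + p) (z + Pi.single s (l * w t))
        (z' + Pi.single t (l * w s)) ↔ Crosses w r ρ N z z' := by
  have key : ∀ a b u : ι → ℕ, a ⬝ᵥ w = b ⬝ᵥ w + l →
      (value w r (N + p) (a + Pi.single s (l * w t) + u) =
          value w r (N + p) (z + Pi.single s (l * w t)) ∧
        (a + Pi.single s (l * w t) + u) ⬝ᵥ w = (z + Pi.single s (l * w t)) ⬝ᵥ w ∧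
        (b + Pi.single t (l * w s) + u) ⬝ᵥ w = (z' + Pi.single t (l * w s)) ⬝ᵥ w ↔
      value w r N (a + u) = value w r N z ∧ (a + u) ⬝ᵥ w = z ⬝ᵥ w ∧
        (b + u) ⬝ᵥ w = z' ⬝ᵥ w) := by
    intro a b u _
    rw [add_right_comm a, add_right_comm b, value_add, value_add z, add_left_inj,
      add_dotProduct (a + u), add_dotProduct z, add_left_inj, add_dotProduct (b + u),
      add_dotProduct z', add_left_inj, value_shift, value_shift]
    refine ⟨fun ⟨h1, h2, h3⟩ => ⟨?_, h2, h3⟩, fun ⟨h1, h2, h3⟩ => ⟨?_, h2, h3⟩⟩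
    · rwa [h2, add_left_inj] at h1
    · rw [h1, h2]
  constructor
  · rintro ⟨A, B, u, hAB, h⟩
    obtain ⟨a, b, hab, hAB'⟩ : ∃ a b, ((a, b) ∈ ρ ∨ (b, a) ∈ ρ) ∧
        shiftPair w s t (a, b) = (A, B) := by
      rcases hAB with ⟨⟨a, b⟩, hab, heq⟩ | ⟨⟨a, b⟩, hab, heq⟩
      · exact ⟨a, b, .inl hab, heq⟩
      · refine ⟨b, a, .inr hab, ?_⟩
        rw [← Prod.swap_prod_mk (a := a), shiftPair_swap, heq, Prod.swap_prod_mk]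
    have hdiff : A ⬝ᵥ w = B ⬝ᵥ w + l := by
      have h2 := h.2.1
      have h3 := h.2.2
      simp only [add_dotProduct, single_dotProduct, hl] at h2 h3
      rw [mul_right_comm] at h3
      lia
    have hlab : a ⬝ᵥ w = b ⬝ᵥ w + l := by
      rcases le_total (b ⬝ᵥ w) (a ⬝ᵥ w) with hle | hle
      · obtain ⟨m, hm⟩ := Nat.exists_eq_add_of_le hle
        rw [shiftPair_of_eq_add hm, Prod.mk.injEq] at hAB'
        obtain ⟨rfl, rfl⟩ := hAB'
        simp only [add_dotProduct, single_dotProduct] at hdiff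
        rw [mul_right_comm] at hdiff
        lia
      · obtain ⟨m, hm⟩ := Nat.exists_eq_add_of_le hle
        rw [← Prod.swap_prod_mk (a := b), shiftPair_swap, shiftPair_of_eq_add hm,
          Prod.swap_prod_mk, Prod.mk.injEq] at hAB'
        obtain ⟨rfl, rfl⟩ := hAB'
        simp only [add_dotProduct, single_dotProduct] at hdiff
        rw [mul_right_comm] at hdiff
        lia
    rw [shiftPair_of_eq_add hlab, Prod.mk.injEq] at hAB'
    obtain ⟨rfl, rfl⟩ := hAB'
    exact ⟨a, b, u, hab, (key a b u hlab).1 h⟩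
  · rintro ⟨a, b, u, hab, h⟩
    have hlab : a ⬝ᵥ w = b ⬝ᵥ w + l := by
      have h2 := h.2.1
      have h3 := h.2.2
      simp only [add_dotProduct] at h2 h3
      lia
    refine ⟨_, _, u, ?_, (key a b u hlab).2 h⟩
    have h1 := shiftPair_of_eq_add (s := s) (t := t) hlab
    have h2 := congrArg Prod.swap h1
    rw [← shiftPair_swap, Prod.swap_prod_mk, Prod.swap_prod_mk] at h2
    rw [← h1, ← h2]
    exact hab.imp (Set.mem_image_of_mem _) (Set.mem_image_of_mem _)

/-- In the stable range `shiftPair` preserves and reflects presentations. -/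
theorem presentation_image_iff (F : ShiftedFamily w r s t p M) (hN : StableRange p M N)
    (hmem : ∀ a b, (a, b) ∈ ρ → value w r N a = value w r N b) :
    (∀ a b, genCon (shiftPair w s t '' ρ) a b ↔ value w r (N + p) a = value w r (N + p) b) ↔
      ∀ a b, genCon ρ a b ↔ value w r N a = value w r N b := by
  rw [F.presentation_iff hN hmem, F.presentation_iff (hN.add p) (F.value_eq_of_mem_image hmem),
    homPart_image_shiftPair]
  refine and_congr_right fun _ => ⟨fun h a b hab => ?_, fun h a b hab => ?_⟩
  · obtain ⟨l, hl⟩ := Nat.exists_eq_add_of_le hab.2.1.le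
    exact (crosses_shift_iff N p hl).1 (h _ _ ((F.consecutive_shift_iff hN hl).2 hab))
  · obtain ⟨l, hl⟩ := Nat.exists_eq_add_of_le hab.2.1.le
    have hp := F.pos_of_dotProduct_ne (hN.add p) hab.1 hab.2.1.ne'
    obtain ⟨a', ha, ha'⟩ := F.exists_homogeneous_offSum_lt hp a
    obtain ⟨b', hb, hb'⟩ := F.exists_homogeneous_offSum_lt hp b
    have hv := (ha.value_eq (N + p)).symm.trans (hab.1.trans (hb.value_eq (N + p)))
    have hl' : a' ⬝ᵥ w = b' ⬝ᵥ w + l := by rw [← ha.1, ← hb.1, hl]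
    obtain ⟨c, rfl⟩ := exists_eq_add_single (F.le_apply_left (hN.add p) ha' hv hl')
    obtain ⟨d, rfl⟩ := exists_eq_add_single (F.le_apply_right (hN.add p) hb' hv.symm hl')
    have hcd : c ⬝ᵥ w = d ⬝ᵥ w + l := by
      simp only [add_dotProduct, single_dotProduct] at hl'
      rw [mul_right_comm] at hl'
      lia
    exact ((crosses_shift_iff N p hcd).2
      (h c d ((F.consecutive_shift_iff hN hcd).1 (hab.congr ha hb)))).congr ha hb

end ShiftedFamily

end ShiftedFamily

theorem shiftedFamily_of_slopes_le {k : ℕ} (hk : 1 ≤ k) (w r : Fin (k + 1) → ℕ)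
    (hw : ∀ i, 1 ≤ w i)
    (hsort : ∀ i j : Fin (k+1), i ≤ j → (r i : ℚ) / (w i : ℚ) ≤ (r j : ℚ) / (w j : ℚ)) :
    ShiftedFamily w r 0 (Fin.last k) (w 0 * r (Fin.last k) - w (Fin.last k) * r 0)
      (univ.sup w * univ.sup r) := by
  have hcross : ∀ i j, i ≤ j → w j * r i ≤ w i * r j := by
    intro i j hij
    have hi : (0 : ℚ) < w i := by exact_mod_cast hw i
    have hj : (0 : ℚ) < w j := by exact_mod_cast hw j
    have h := (div_le_div_iff₀ hi hj).1 (hsort i j hij)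
    have h' : r i * w j ≤ r j * w i := by exact_mod_cast h
    rwa [mul_comm (w j), mul_comm (w i)]
  have hwsup : ∀ i, w i ≤ univ.sup w := fun i => le_sup (mem_univ i)
  have hrsup : ∀ i, r i ≤ univ.sup r := fun i => le_sup (mem_univ i)
  refine ⟨?_, hw, Nat.sub_add_cancel (hcross _ _ (Fin.zero_le _)),
    fun i => hcross _ _ (Fin.zero_le _), fun i => hcross _ _ (Fin.le_last i), fun i => ?_,
    fun i => ?_⟩
  · rw [ne_comm, Ne, Fin.last_eq_zero_iff]
    lia
  · refine (Nat.sub_le _ _).trans (Nat.mul_le_mul_left _ ((hrsup i).trans ?_))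
    exact Nat.le_mul_of_pos_left _ ((hw 0).trans (hwsup 0))
  · exact (Nat.sub_le _ _).trans (Nat.mul_le_mul (hwsup i) (hrsup _))

theorem stableRange_of_lt {a p W R N : ℕ} (ha : 1 ≤ a) (hW : 1 ≤ W) (hp : p ≤ a * R)
    (hN : a ^ 2 * W * R ^ 2 < N) : StableRange p (W * R) N := by
  obtain ⟨a, rfl⟩ := Nat.exists_eq_add_of_le' ha
  obtain ⟨W, rfl⟩ := Nat.exists_eq_add_of_le' hW
  constructor
  · have h1 : (W + 1) * R * p ≤ (W + 1) * R * ((a + 1) * R) := by gcongr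
    have h2 : R ≤ R ^ 2 := Nat.le_self_pow two_ne_zero R
    have h3 : a * R ≤ a * R ^ 2 := by gcongr
    have h4 : 0 ≤ a * W * R ^ 2 + a ^ 2 * (W + 1) * R ^ 2 := Nat.zero_le _
    nlinarith
  · refine lt_of_le_of_lt ?_ hN
    calc (W + 1) * R * p ≤ (W + 1) * R * ((a + 1) * R) := by gcongr
      _ = (a + 1) * ((W + 1) * R ^ 2) := by ring
      _ ≤ (a + 1) ^ 2 * ((W + 1) * R ^ 2) := by
        gcongr
        exact Nat.le_self_pow two_ne_zero _
      _ = _ := by ring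

/-- Theorem (minimal presentations of `P_n = ⟨w₁n+r₁,…,w_kn+r_k⟩` transfer): for
`n > w₁²·W·R²`, the image under `Φ_n` of any minimal presentation of `P_n` is a
minimal presentation of `P_{n+p}`, where `p = w₁r_k − w_kr₁`.  A presentation of `P_N`
is a set `ρ ⊆ ker π_N` whose congruence closure (smallest reflexive, symmetric,
transitive, translation-closed relation containing `ρ`) equals `ker π_N`; it is
minimal if no proper subset is a presentation. -/
theorem stmt_12 (k : ℕ) (hk : 1 ≤ k)
    (w r : Fin (k+1) → ℕ) (hw : ∀ i, 1 ≤ w i) (hr0 : r 0 < w 0)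
    (hsort : ∀ i j : Fin (k+1), i ≤ j → (r i : ℚ) / (w i : ℚ) ≤ (r j : ℚ) / (w j : ℚ))
    (p : ℕ) (hp : p = w 0 * r (Fin.last k) - w (Fin.last k) * r 0)
    (π : ℕ → (Fin (k+1) → ℕ) → ℕ)
    (hπ : ∀ N : ℕ, ∀ z : Fin (k+1) → ℕ, π N z = ∑ i, z i * (w i * N + r i))
    (congClosure : Set ((Fin (k+1) → ℕ) × (Fin (k+1) → ℕ)) →
      Set ((Fin (k+1) → ℕ) × (Fin (k+1) → ℕ)))
    (hcc : ∀ ρ, congClosure ρ = ⋂₀ {C | ρ ⊆ C ∧ (∀ a, (a, a) ∈ C) ∧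
      (∀ a b, (a, b) ∈ C → (b, a) ∈ C) ∧
      (∀ a b c, (a, b) ∈ C → (b, c) ∈ C → (a, c) ∈ C) ∧
      (∀ a b u, (a, b) ∈ C → (a + u, b + u) ∈ C)})
    (isPres : ℕ → Set ((Fin (k+1) → ℕ) × (Fin (k+1) → ℕ)) → Prop)
    (hisPres : ∀ N ρ, isPres N ρ ↔ (∀ q ∈ ρ, π N q.1 = π N q.2) ∧
      congClosure ρ = {q : (Fin (k+1) → ℕ) × (Fin (k+1) → ℕ) | π N q.1 = π N q.2})
    (isMinPres : ℕ → Set ((Fin (k+1) → ℕ) × (Fin (k+1) → ℕ)) → Prop)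
    (hisMin : ∀ N ρ, isMinPres N ρ ↔ isPres N ρ ∧ ∀ ρ' ⊂ ρ, ¬ isPres N ρ')
    (Φ : ((Fin (k+1) → ℕ) × (Fin (k+1) → ℕ)) → ((Fin (k+1) → ℕ) × (Fin (k+1) → ℕ)))
    (hΦ : ∀ z z' : Fin (k+1) → ℕ, Φ (z, z') =
      if ∑ i, z' i * w i < ∑ i, z i * w i then
        (z + Pi.single 0 ((∑ i, z i * w i - ∑ i, z' i * w i) * w (Fin.last k)),
         z' + Pi.single (Fin.last k) ((∑ i, z i * w i - ∑ i, z' i * w i) * w 0))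
      else if ∑ i, z i * w i < ∑ i, z' i * w i then
        (z + Pi.single (Fin.last k) ((∑ i, z' i * w i - ∑ i, z i * w i) * w 0),
         z' + Pi.single 0 ((∑ i, z' i * w i - ∑ i, z i * w i) * w (Fin.last k)))
      else (z, z'))
    (n : ℕ) (hn : (w 0) ^ 2 * (Finset.univ.sup w) * (Finset.univ.sup r) ^ 2 < n)
    (ρ : Set ((Fin (k+1) → ℕ) × (Fin (k+1) → ℕ)))
    (hρ : isMinPres n ρ) :
    isMinPres (n + p) (Φ '' ρ) := by
  obtain rfl : Φ = shiftPair w 0 (Fin.last k) := by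
    funext ⟨z, z'⟩
    exact hΦ z z'
  have hval : ∀ N z, π N z = value w r N z := by
    intro N z
    rw [hπ, value, dotProduct, dotProduct, mul_sum, ← sum_add_distrib]
    exact sum_congr rfl fun i _ => by ring
  have hpres : ∀ N ρ, isPres N ρ ↔ ∀ a b, genCon ρ a b ↔ value w r N a = value w r N b := by
    intro N ρ
    simp only [hisPres, hcc, sInter_eq_genCon, hval, Set.ext_iff, Prod.forall, Set.mem_ofPred_eq]
    exact and_iff_right_of_imp fun h a b hab => (h a b).1 (genCon_of_mem hab)
  have F := shiftedFamily_of_slopes_le hk w r hw hsort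
  rw [← hp] at F
  have hN : StableRange p (univ.sup w * univ.sup r) n := by
    refine stableRange_of_lt (hw 0) ((hw 0).trans (le_sup (mem_univ 0))) ?_ hn
    rw [hp]
    exact (Nat.sub_le _ _).trans (Nat.mul_le_mul_left _ (le_sup (mem_univ _)))
  rw [hisMin] at hρ ⊢
  have hmem := ((hisPres n ρ).1 hρ.1).1
  have himage : ∀ ρ' ⊆ ρ, isPres (n + p) (shiftPair w 0 (Fin.last k) '' ρ') ↔ isPres n ρ' := by
    intro ρ' hρ'
    rw [hpres, hpres]
    refine F.presentation_image_iff hN fun a b hab => ?_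
    simpa only [hval] using hmem _ (hρ' hab)
  refine ⟨(himage ρ subset_rfl).2 hρ.1, fun σ hσ hpresσ => ?_⟩
  obtain ⟨ρ', hρ', rfl⟩ := Set.subset_image_iff.1 hσ.subset
  refine hρ.2 ρ' (hρ'.ssubset_of_ne ?_) ((himage ρ' hρ').1 hpresσ)
  rintro rfl
  exact hσ.ne rfl
end
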